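/- Every infinite complete Boolean algebra B (i.e., every subset of B has a supremum) has an ultrafilter U such that (U,≥) ≡_T ([|B|]^{<ω},⊆). -/

import Mathlib

open Cardinal

/-- A subset `X` of a preorder is cofinal if every element has an upper bound in `X`. -/
def TCofinal {P : Type*} [Preorder P] (X : Set P) : Prop :=
  ∀ p : P, ∃ x ∈ X, p ≤ x

/-- A map is cofinal if it sends cofinal sets to cofinal sets. -/
def TCofinalMap {P Q : Type*} [Preorder P] [Preorder Q] (f : P → Q) : Prop :=
  ∀ X : Set P, TCofinal X → TCofinal (f '' X)

/-- `P ≤_T Q`: there is a cofinal map from `Q` to `P`. -/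
def TukeyLE (P Q : Type*) [Preorder P] [Preorder Q] : Prop :=
  ∃ f : Q → P, TCofinalMap f

/-- Tukey equivalence. -/
def TukeyEquiv (P Q : Type*) [Preorder P] [Preorder Q] : Prop :=
  TukeyLE P Q ∧ TukeyLE Q P

/-- An ultrafilter on a Boolean algebra `B`. -/
structure BAUltrafilter (B : Type*) [BooleanAlgebra B] where
  carrier : Set B
  bot_not_mem : ⊥ ∉ carrier
  inf_mem : ∀ a ∈ carrier, ∀ b ∈ carrier, a ⊓ b ∈ carrier
  up_closed : ∀ a ∈ carrier, ∀ b : B, a ≤ b → b ∈ carrier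
  mem_or_compl_mem : ∀ b : B, b ∈ carrier ∨ bᶜ ∈ carrier

universe u

namespace BF

open Set

/-- Independence of a family `a`, below the element `x`. -/
def Ind {B : Type u} [BooleanAlgebra B] {K : Type u} (x : B) (a : K → B) : Prop :=
  ∀ (S : Finset K) (σ : K → Prop), ∃ y : B, y ≠ ⊥ ∧ y ≤ x ∧
    ∀ k ∈ S, (σ k → y ≤ a k) ∧ (¬ σ k → Disjoint y (a k))

theorem cofinalMap_of_monotone {P Q : Type*} [Preorder P] [Preorder Q] (f : P → Q)
    (hf : Monotone f) (hc : ∀ q, ∃ p, q ≤ f p) : TCofinalMap f := by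
  intro X hX q
  obtain ⟨p, hp⟩ := hc q
  obtain ⟨x, hx, hpx⟩ := hX p
  exact ⟨f x, ⟨x, hx, rfl⟩, hp.trans (hf hpx)⟩

theorem finset_inf_mem {B : Type u} [BooleanAlgebra B] (U : BAUltrafilter B) (htop : ⊤ ∈ U.carrier)
    (F : Finset B) (h : ∀ b ∈ F, b ∈ U.carrier) : F.inf id ∈ U.carrier := by
  classical
  induction F using Finset.induction_on with
  | empty => simpa using htop
  | insert a s ha ih =>
    rw [Finset.inf_insert]
    exact U.inf_mem _ (h a (by simp)) _ (ih (fun b hb => h b (by simp [hb])))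

/-- Extending a family with the finite meet property to an ultrafilter. -/
theorem exists_ultrafilter {B : Type u} [BooleanAlgebra B] (G : Set B)
    (hG : ∀ F : Finset B, (∀ b ∈ F, b ∈ G) → F.inf id ≠ ⊥) :
    ∃ U : BAUltrafilter B, G ⊆ U.carrier := by
  classical
  let S : Set (Set B) := {H | ∀ F : Finset B, (∀ b ∈ F, b ∈ H) → F.inf id ≠ ⊥}
  obtain ⟨M, hGM, hM⟩ := zorn_subset_nonempty S (by
    intro c hcS hc hne
    refine ⟨⋃₀ c, ?_, fun s hs => subset_sUnion_of_mem hs⟩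
    intro F hF
    have : ∃ t ∈ c, ∀ b ∈ F, b ∈ t := by
      have := DirectedOn.exists_mem_subset_of_finset_subset_biUnion (c := c) (f := id) hne
        (hc.directedOn) (s := F) (by
          intro b hb
          obtain ⟨t, ht, hbt⟩ := hF b hb
          simp only [mem_iUnion]
          exact ⟨t, ht, hbt⟩)
      obtain ⟨t, ht, h⟩ := this
      exact ⟨t, ht, fun b hb => h hb⟩
    obtain ⟨t, ht, h⟩ := this
    exact hcS ht F h) G hG
  have hMS : ∀ F : Finset B, (∀ b ∈ F, b ∈ M) → F.inf id ≠ ⊥ := hM.1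
  have key : ∀ b : B, (∀ F : Finset B, (∀ c ∈ F, c ∈ M) → F.inf id ⊓ b ≠ ⊥) → b ∈ M := by
    intro b hb
    have : insert b M ∈ S := by
      intro F hF
      have h1 := hb (F.erase b) (by
        intro c hc
        have := hF c (Finset.mem_of_mem_erase hc)
        rcases this with h | h
        · exact absurd h (Finset.ne_of_mem_erase hc)
        · exact h)
      intro h0
      apply h1
      rw [← le_bot_iff, ← h0]
      apply Finset.le_inf
      intro c hc
      by_cases hcb : c = b
      · subst hcb; exact inf_le_right
      · exact inf_le_left.trans (Finset.inf_le (f := id) (Finset.mem_erase.2 ⟨hcb, hc⟩))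
    exact hM.2 this (subset_insert _ _) (mem_insert _ _)
  have hnb : ∀ b, b ∉ M → ∃ F : Finset B, (∀ c ∈ F, c ∈ M) ∧ F.inf id ⊓ b = ⊥ := by
    intro b hb
    by_contra hcon
    push Not at hcon
    exact hb (key b hcon)
  refine ⟨⟨M, ?_, ?_, ?_, ?_⟩, hGM⟩
  · intro h
    exact hMS {⊥} (by simpa using h) (by simp)
  · intro a ha b hb
    apply key
    intro F hF
    have := hMS (insert a (insert b F)) (by
      intro c hc
      simp only [Finset.mem_insert] at hc
      rcases hc with rfl | rfl | hc
      · exact ha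
      · exact hb
      · exact hF c hc)
    intro h0
    apply this
    rw [Finset.inf_insert, Finset.inf_insert, ← h0]
    simp only [id]
    rw [← inf_assoc, inf_comm]
  · intro a ha b hab
    apply key
    intro F hF
    have := hMS (insert a F) (by
      intro c hc
      simp only [Finset.mem_insert] at hc
      rcases hc with rfl | hc
      · exact ha
      · exact hF c hc)
    intro h0
    apply this
    rw [Finset.inf_insert, ← le_bot_iff, ← h0]
    simp only [id]
    exact le_inf inf_le_right (inf_le_left.trans hab)
  · intro b
    by_contra hcon
    push Not at hcon
    obtain ⟨F1, h1, h1'⟩ := hnb b hcon.1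
    obtain ⟨F2, h2, h2'⟩ := hnb bᶜ hcon.2
    refine hMS (F1 ∪ F2) ?_ ?_
    · intro c hc
      rcases Finset.mem_union.1 hc with h | h
      · exact h1 c h
      · exact h2 c h
    · rw [Finset.inf_union, ← le_bot_iff]
      have e1 : F1.inf id ≤ bᶜ := by
        rw [le_compl_iff_disjoint_right, disjoint_iff]; exact h1'
      have e2 : F2.inf id ≤ b := by
        have : F2.inf id ≤ bᶜᶜ := by
          rw [le_compl_iff_disjoint_right, disjoint_iff]; exact h2'
        simpa using this
      calc F1.inf id ⊓ F2.inf id ≤ bᶜ ⊓ b := inf_le_inf e1 e2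
        _ ≤ ⊥ := by simp

theorem top_mem {B : Type u} [BooleanAlgebra B] (U : BAUltrafilter B) : ⊤ ∈ U.carrier := by
  rcases U.mem_or_compl_mem ⊤ with h | h
  · exact h
  · simp only [compl_top] at h
    exact absurd h U.bot_not_mem

/-- From an independent family of full size to the Tukey-top ultrafilter. -/
theorem tukey_of_ind {B : Type u} [BooleanAlgebra B] (a : B → B) (ha : Ind (⊤ : B) a) :
    ∃ U : BAUltrafilter B, TukeyEquiv ((↥U.carrier)ᵒᵈ) (Finset B) := by
  classical
  let G : Set B := range a ∪ {c | ∃ b : B, c = bᶜ ∧ {k | b ≤ a k}.Infinite}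
  obtain ⟨U, hU⟩ := exists_ultrafilter G (by
    intro F hF
    -- indices of positive members
    have h1 : ∀ c : B, ∃ k : B, c ∈ range a → a k = c := by
      intro c
      by_cases h : c ∈ range a
      · obtain ⟨k, hk⟩ := h
        exact ⟨k, fun _ => hk⟩
      · exact ⟨⊥, fun h' => absurd h' h⟩
    choose f hf using h1
    let P : Finset B := F.image f
    have h2 : ∀ c : B, ∃ k : B, k ∉ P ∧
        ((∃ b : B, c = bᶜ ∧ {k | b ≤ a k}.Infinite) → (a k)ᶜ ≤ c) := by
      intro c
      by_cases h : ∃ b : B, c = bᶜ ∧ {k | b ≤ a k}.Infinite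
      · obtain ⟨b, rfl, hb⟩ := h
        obtain ⟨k, hk, hkP⟩ := hb.exists_notMem_finset P
        exact ⟨k, hkP, fun _ => compl_le_compl hk⟩
      · by_cases hi : Infinite B
        · obtain ⟨k, hk⟩ := Infinite.exists_notMem_finset P
          exact ⟨k, hk, fun h' => absurd h' h⟩
        · exfalso
          rw [not_infinite_iff_finite] at hi
          obtain ⟨y, hy0, -, hy⟩ := ha (Set.Finite.toFinset (Set.toFinite (Set.univ : Set B)))
            (fun _ => True)
          obtain ⟨z, hz0, -, hz⟩ := ha (Set.Finite.toFinset (Set.toFinite (Set.univ : Set B)))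
            (fun _ => False)
          -- a finite algebra cannot have an independent family indexed by itself
          have hinj : Function.Injective a := by
            intro k l hkl
            by_contra hne
            obtain ⟨y, hy0, -, hy⟩ := ha {k, l} (fun i => i = k)
            have e1 := (hy k (by simp)).1 rfl
            have e2 := (hy l (by simp)).2 (fun h => hne h.symm)
            rw [hkl] at e1
            exact hy0 (disjoint_self.1 (e2.mono_right e1))
          have hsurj := Finite.injective_iff_surjective.1 hinj
          obtain ⟨k, hk⟩ := hsurj ⊥
          have := (hy k (by simp)).1 trivial
          rw [hk, le_bot_iff] at this
          exact hy0 this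
    choose g hg hg' using h2
    obtain ⟨y, hy0, -, hy⟩ := ha (P ∪ F.image g) (fun k => k ∈ P)
    intro h0
    apply hy0
    rw [← le_bot_iff, ← h0]
    apply Finset.le_inf
    intro c hc
    rcases hF c hc with h | h
    · have e := (hy (f c) (by
        simp only [Finset.mem_union]; left; exact Finset.mem_image_of_mem f hc)).1
          (Finset.mem_image_of_mem f hc)
      rw [hf c h] at e
      exact e
    · have e := (hy (g c) (by
        simp only [Finset.mem_union]; right; exact Finset.mem_image_of_mem g hc)).2 (hg c)
      exact (le_compl_iff_disjoint_right.2 e).trans (hg' c h))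
  have hfin : ∀ u : U.carrier, {k | (u : B) ≤ a k}.Finite := by
    intro u
    by_contra hcon
    have : (u : B)ᶜ ∈ U.carrier := hU (Or.inr ⟨u, rfl, hcon⟩)
    have h := U.inf_mem _ u.2 _ this
    rw [inf_compl_eq_bot] at h
    exact U.bot_not_mem h
  refine ⟨U, ?_, ?_⟩
  · refine ⟨fun F => OrderDual.toDual ⟨(F.filter (· ∈ U.carrier)).inf id,
      finset_inf_mem U (top_mem U) _ (by simp)⟩, cofinalMap_of_monotone _ ?_ ?_⟩
    · intro F F' h
      change (F'.filter (· ∈ U.carrier)).inf id ≤ (F.filter (· ∈ U.carrier)).inf id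
      exact Finset.inf_mono (Finset.filter_subset_filter _ h)
    · intro q
      refine ⟨{((OrderDual.ofDual q : U.carrier) : B)}, ?_⟩
      change (Finset.filter (· ∈ U.carrier) {((OrderDual.ofDual q : U.carrier) : B)}).inf id
        ≤ ((OrderDual.ofDual q : U.carrier) : B)
      apply Finset.inf_le (f := id)
      simp
  · refine ⟨fun u => (hfin (OrderDual.ofDual u)).toFinset, cofinalMap_of_monotone _ ?_ ?_⟩
    · intro u v h k hk
      simp only [Finite.mem_toFinset, mem_ofPred_eq] at hk ⊢
      have h' : ((OrderDual.ofDual v : U.carrier) : B) ≤ (OrderDual.ofDual u : U.carrier) := h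
      exact h'.trans hk
    · intro F
      refine ⟨OrderDual.toDual ⟨(F.image a).inf id, finset_inf_mem U (top_mem U) _ ?_⟩, ?_⟩
      · intro b hb
        obtain ⟨k, -, rfl⟩ := Finset.mem_image.1 hb
        exact hU (Or.inl ⟨k, rfl⟩)
      · intro k hk
        simp only [Finite.mem_toFinset, mem_ofPred_eq, OrderDual.ofDual_toDual]
        exact Finset.inf_le (f := id) (Finset.mem_image_of_mem a hk)

theorem maxAnti {B : Type u} [BooleanAlgebra B] (Q : B → Prop) :
    ∃ M : Set B, (∀ m ∈ M, Q m ∧ m ≠ ⊥) ∧ (∀ m ∈ M, ∀ n ∈ M, m ≠ n → Disjoint m n) ∧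
      ∀ x, Q x → x ≠ ⊥ → ∃ m ∈ M, ¬ Disjoint x m := by
  let S : Set (Set B) := {M | (∀ m ∈ M, Q m ∧ m ≠ ⊥) ∧ ∀ m ∈ M, ∀ n ∈ M, m ≠ n → Disjoint m n}
  obtain ⟨M, hM⟩ := zorn_subset S (by
    intro c hc hch
    refine ⟨⋃₀ c, ⟨?_, ?_⟩, fun s hs => subset_sUnion_of_mem hs⟩
    · rintro m ⟨t, ht, hm⟩
      exact (hc ht).1 m hm
    · rintro m ⟨t, ht, hm⟩ n ⟨s, hs, hn⟩ hne
      rcases hch.total ht hs with h | h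
      · exact (hc hs).2 m (h hm) n hn hne
      · exact (hc ht).2 m hm n (h hn) hne)
  refine ⟨M, hM.1.1, hM.1.2, ?_⟩
  intro x hQ hx
  by_contra hcon
  push Not at hcon
  have : insert x M ∈ S := by
    refine ⟨?_, ?_⟩
    · rintro m (rfl | hm)
      · exact ⟨hQ, hx⟩
      · exact hM.1.1 m hm
    · rintro m (rfl | hm) n (rfl | hn) hne
      · exact absurd rfl hne
      · exact hcon n hn
      · exact (hcon m hm).symm
      · exact hM.1.2 m hm n hn hne
  have hxM : x ∈ M := hM.2 this (subset_insert _ _) (mem_insert _ _)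
  exact hx (disjoint_self.1 (hcon x hxM))

theorem mix {B : Type u} [CompleteBooleanAlgebra B] {I : Type u} (p b : I → B)
    (hp : ∀ i j, i ≠ j → Disjoint (p i) (p j)) (i : I) (y : B) (hy : y ≤ p i) :
    (y ≤ b i → y ≤ ⨆ j, p j ⊓ b j) ∧ (Disjoint y (b i) → Disjoint y (⨆ j, p j ⊓ b j)) := by
  refine ⟨fun h => (le_inf hy h).trans (le_iSup (fun j => p j ⊓ b j) i), fun h => ?_⟩
  rw [disjoint_iSup_iff]
  intro j
  by_cases hij : i = j
  · subst hij
    exact h.mono_right inf_le_right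
  · exact ((hp i j hij).mono_left hy).mono_right inf_le_left

set_option linter.deprecated false in
theorem exists_wo (c : Cardinal.{u}) : ∃ (K : Type u) (_ : LinearOrder K) (_ : WellFoundedLT K),
    #K = c ∧ (∀ k : K, #(Iio k) < c) ∧ ∀ ν < c, ∃ k : K, ν ≤ #(Iio k) := by
  refine ⟨c.ord.ToType, inferInstance, inferInstance, mk_ord_toType c, fun k => mk_Iio_toType_ord_lt k, ?_⟩
  intro ν hν
  have hlt : ν.ord < c.ord := ord_lt_ord.2 hν
  let k : c.ord.ToType := Ordinal.ToType.mk ⟨ν.ord, hlt⟩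
  refine ⟨k, ?_⟩
  have hh : ∃ f : ν.ord.ToType → Iio k, Function.Injective f := by
    refine ⟨fun t =>
    ⟨Ordinal.ToType.mk ⟨((Ordinal.ToType.mk.symm t : Iio ν.ord) : Ordinal),
      lt_trans (mem_Iio.1 (Ordinal.ToType.mk.symm t).2) hlt⟩, by
      simp only [mem_Iio, k, OrderIso.lt_iff_lt]
      exact (Ordinal.ToType.mk.symm t).2⟩, ?_⟩
    intro s t h
    have h' : ((Ordinal.ToType.mk.symm s : Iio ν.ord) : Ordinal) =
        ((Ordinal.ToType.mk.symm t : Iio ν.ord) : Ordinal) := by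
      simpa [Subtype.ext_iff] using h
    exact Ordinal.ToType.mk.symm.injective (Subtype.ext h')
  obtain ⟨f, hf⟩ := hh
  have := mk_le_of_injective hf
  simpa using this

/-- Injective choice from large sets. -/
theorem inj_choice {E : Type u} {A : Type u} (Y : E → Set A) (h : ∀ x, #E < #(Y x)) :
    ∃ g : E → A, Function.Injective g ∧ ∀ x, g x ∈ Y x := by
  classical
  obtain ⟨r, wo⟩ := exists_wellFoundedLT E
  have hne : ∀ (x : E) (ih : (y : E) → y < x → A), ∃ z ∈ Y x, ∀ y (hy : y < x), z ≠ ih y hy := by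
    intro x ih
    by_contra hcon
    push Not at hcon
    have : Y x ⊆ range (fun y : {y // y < x} => ih y.1 y.2) := by
      intro z hz
      obtain ⟨y, hy, e⟩ := hcon z hz
      exact ⟨⟨y, hy⟩, e.symm⟩
    have h1 := mk_le_mk_of_subset this
    have h2 := h1.trans mk_range_le
    have h3 : #{y // y < x} ≤ #E := mk_subtype_le _
    exact absurd (h2.trans h3) (not_le.2 (h x))
  let g : E → A := WellFounded.fix (wellFounded_lt (α := E)) (fun x ih => (hne x ih).choose)
  have hg : ∀ x, g x ∈ Y x ∧ ∀ y (hy : y < x), g x ≠ g y := by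
    intro x
    have : g x = (hne x (fun y _ => g y)).choose := WellFounded.fix_eq _ _ _
    rw [this]
    exact (hne x (fun y _ => g y)).choose_spec
  refine ⟨g, ?_, fun x => (hg x).1⟩
  intro x y hxy
  rcases lt_trichotomy x y with h | h | h
  · exact absurd hxy.symm ((hg y).2 x h)
  · exact h
  · exact absurd hxy ((hg x).2 y h)

/-- The complete subalgebra generated by `D`. -/
inductive Clo {B : Type u} [CompleteBooleanAlgebra B] (D : Set B) : B → Prop
  | base (d : B) (h : d ∈ D) : Clo D d
  | compl (d : B) (h : Clo D d) : Clo D dᶜ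
  | sup (S : Set B) (h : ∀ s ∈ S, Clo D s) : Clo D (sSup S)

section
variable {B : Type u} [CompleteBooleanAlgebra B]

theorem Clo.mono {D D' : Set B} (h : D ⊆ D') {d : B} (hd : Clo D d) : Clo D' d := by
  induction hd with
  | base d hd => exact Clo.base d (h hd)
  | compl d _ ih => exact Clo.compl d ih
  | sup S _ ih => exact Clo.sup S ih

theorem Clo.inf' {D : Set B} (S : Set B) (h : ∀ s ∈ S, Clo D s) : Clo D (sInf S) := by
  have : sInf S = (sSup ((fun x : B => xᶜ) '' S))ᶜ := by
    rw [sSup_image, compl_iSup]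
    simp [compl_iSup, sInf_eq_iInf]
  rw [this]
  refine Clo.compl _ (Clo.sup _ ?_)
  rintro _ ⟨s, hs, rfl⟩
  exact Clo.compl _ (h s hs)

theorem Clo.inf {D : Set B} {a b : B} (ha : Clo D a) (hb : Clo D b) : Clo D (a ⊓ b) := by
  rw [← sInf_pair]
  apply Clo.inf'
  rintro s (rfl | rfl) <;> assumption

theorem Clo.top {D : Set B} : Clo D ⊤ := by
  rw [← _root_.sInf_empty (α := B)]
  exact Clo.inf' _ (by simp)

/-- `D` completely generates the algebra below `x`. -/
def Gen (D : Set B) (x : B) : Prop := ∀ y ≤ x, ∃ d, Clo D d ∧ y = d ⊓ x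

/-- The lemma of Vladimirov. -/
theorem vladimirov (D : Set B) (e : B) (h : ∀ x ≤ e, x ≠ ⊥ → ¬ Gen D x) :
    ∃ a : B, ∀ d, Clo D d → d ⊓ e ≠ ⊥ → d ⊓ e ⊓ a ≠ ⊥ ∧ d ⊓ e ⊓ aᶜ ≠ ⊥ := by
  classical
  let Sp : B → B → Prop := fun c u => u ≤ c ∧ u ≤ e ∧
    ∀ d, Clo D d → d ≤ c → d ≠ ⊥ → d ⊓ u ≠ ⊥ ∧ d ⊓ e ⊓ uᶜ ≠ ⊥
  have dense : ∀ b, Clo D b → b ⊓ e ≠ ⊥ → ∃ c, c ≤ b ∧ c ≠ ⊥ ∧ Clo D c ∧ ∃ u, Sp c u := by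
    intro b hb hbe
    have hx := h (b ⊓ e) inf_le_right hbe
    unfold Gen at hx
    push Not at hx
    obtain ⟨y, hy, hyd⟩ := hx
    let pr : B → B := fun y => sInf {d | Clo D d ∧ y ≤ d}
    have prC : ∀ y, Clo D (pr y) := fun y => Clo.inf' _ (fun s hs => hs.1)
    have lepr : ∀ y, y ≤ pr y := fun y => le_sInf (fun s hs => hs.2)
    have prle : ∀ y d, Clo D d → y ≤ d → pr y ≤ d := fun y d h1 h2 => sInf_le ⟨h1, h2⟩
    let x := b ⊓ e
    let w := x ⊓ yᶜ
    let c := b ⊓ pr y ⊓ pr w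
    have hcC : Clo D c := (hb.inf (prC y)).inf (prC w)
    have hmeet : ∀ z, pr z ≥ c → ∀ d, Clo D d → d ≤ c → d ≠ ⊥ → d ⊓ z ≠ ⊥ := by
      intro z hz d hd hdc hd0 h0
      have : z ≤ dᶜ := le_compl_iff_disjoint_right.2 (disjoint_iff.2 (by rw [inf_comm]; exact h0))
      have h2 := prle z dᶜ (hd.compl) this
      have h3 : d ≤ dᶜ := hdc.trans (hz.le.trans h2)
      exact hd0 (le_compl_self.1 h3)
    refine ⟨c, inf_le_left.trans inf_le_left, ?_, hcC, y ⊓ c, inf_le_right,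
      inf_le_left.trans (hy.trans inf_le_right), ?_⟩
    · intro hc0
      apply hyd (pr y) (prC y)
      apply le_antisymm
      · exact le_inf (lepr y) hy
      · have h1 : pr y ⊓ x ⊓ yᶜ ≤ ⊥ := by
          rw [← hc0]
          refine le_inf (le_inf ?_ ?_) ?_
          · exact inf_le_left.trans (inf_le_right.trans inf_le_left)
          · exact inf_le_left.trans inf_le_left
          · refine le_trans ?_ (lepr w)
            exact le_inf (inf_le_left.trans inf_le_right) inf_le_right
        have h2 : Disjoint (pr y ⊓ x) yᶜ := disjoint_iff_inf_le.2 h1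
        have h3 := le_compl_iff_disjoint_right.2 h2
        simpa using h3
    · intro d hd hdc hd0
      constructor
      · have := hmeet y (inf_le_left.trans inf_le_right) d hd hdc hd0
        intro h0
        apply this
        rw [← le_bot_iff, ← h0]
        exact le_inf inf_le_left (le_inf inf_le_right (inf_le_left.trans hdc))
      · have := hmeet w inf_le_right d hd hdc hd0
        intro h0
        apply this
        rw [← le_bot_iff, ← h0]
        refine le_inf (le_inf inf_le_left ?_) ?_
        · exact inf_le_right.trans (inf_le_left.trans inf_le_right)
        · exact inf_le_right.trans (inf_le_right.trans (compl_le_compl inf_le_left))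
  obtain ⟨M, hM1, hM2, hM3⟩ := maxAnti (fun c => Clo D c ∧ ∃ u, Sp c u)
  have : ∀ c : M, ∃ u, Sp c.1 u := fun c => (hM1 c.1 c.2).1.2
  choose u hu using this
  refine ⟨⨆ c, u c, ?_⟩
  intro d hd hde
  obtain ⟨c', hc'd, hc'0, hc'C, hc'u⟩ := dense d hd hde
  obtain ⟨c, hcM, hcc⟩ := hM3 c' ⟨hc'C, hc'u⟩ hc'0
  have hd' : Clo D (c' ⊓ c) := hc'C.inf (hM1 c hcM).1.1
  have hd'0 : c' ⊓ c ≠ ⊥ := fun h => hcc (disjoint_iff.2 h)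
  obtain ⟨h1, h2⟩ := (hu ⟨c, hcM⟩).2.2 (c' ⊓ c) hd' inf_le_right hd'0
  have hue := (hu ⟨c, hcM⟩).2.1
  constructor
  · intro h0
    apply h1
    rw [← le_bot_iff, ← h0]
    refine le_inf (le_inf ?_ ?_) ?_
    · exact inf_le_left.trans (inf_le_left.trans hc'd)
    · exact inf_le_right.trans hue
    · exact inf_le_right.trans (le_iSup u ⟨c, hcM⟩)
  · intro h0
    apply h2
    rw [← le_bot_iff, ← h0]
    refine le_inf (le_inf ?_ ?_) ?_
    · exact inf_le_left.trans (inf_le_left.trans (inf_le_left.trans hc'd))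
    · exact inf_le_left.trans inf_le_right
    · rw [le_compl_iff_disjoint_right, disjoint_iSup_iff]
      intro m
      by_cases hm : m = ⟨c, hcM⟩
      · subst hm
        exact (disjoint_compl_left).mono_left inf_le_right
      · have hmc : Disjoint c m.1 := hM2 c hcM m.1 m.2 (fun h => hm (Subtype.ext h.symm))
        exact (hmc.mono_left (inf_le_left.trans (inf_le_left.trans inf_le_right))).mono_right (hu m).1

/-- Size of complete subalgebras. -/
theorem clo_card (D : Set B) (e : B) (J : Type u) [Nonempty J] (I : J → Type u) [∀ j, Infinite (I j)]
    (hI : ∀ A : Set B, (∀ a ∈ A, a ≤ e ∧ a ≠ ⊥) → (∀ a ∈ A, ∀ b ∈ A, a ≠ b → Disjoint a b) →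
      ∃ j, #A ≤ #(I j))
    (L : Cardinal.{u}) (hL0 : ℵ₀ ≤ L) (hLJ : #J ≤ L) (hLD : #D ≤ L) (hL : ∀ j, L ^ #(I j) ≤ L)
    (hgen : Gen D e) : #(Iic e) ≤ L := by
  classical
  let α := Option D ⊕ (PUnit.{u+1} ⊕ J)
  let β : α → Type u := Sum.elim (fun _ => PEmpty) (Sum.elim (fun _ => PUnit) I)
  have hW : #(WType β) ≤ L := by
    apply WType.cardinalMk_le_of_le
    have : ∀ a : α, L ^ #(β a) ≤ L := by
      rintro (a | a | j)
      · simp only [β, Sum.elim_inl, mk_pempty, power_zero]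
        exact one_le_aleph0.trans hL0
      · simp [β]
      · exact hL j
    refine (sum_le_sum _ (fun _ => L) this).trans ?_
    rw [sum_const']
    have hα : #α ≤ L := by
      simp only [α, mk_sum, mk_option, lift_id, mk_punit]
      refine add_le_of_le hL0 (add_le_of_le hL0 hLD (one_le_aleph0.trans hL0))
        (add_le_of_le hL0 (one_le_aleph0.trans hL0) hLJ)
    exact mul_le_of_le hL0 hα le_rfl
  let step : (Σ a : α, β a → B) → B := fun s => match s with
    | ⟨Sum.inl none, _⟩ => ⊥
    | ⟨Sum.inl (some d), _⟩ => d.1 ⊓ e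
    | ⟨Sum.inr (Sum.inl _), f⟩ => e ⊓ (f PUnit.unit)ᶜ
    | ⟨Sum.inr (Sum.inr _), f⟩ => ⨆ i, f i
  let ev : WType β → B := WType.elim B step
  let R : Set B := range ev
  have hbot : ⊥ ∈ R := ⟨WType.mk (Sum.inl none) PEmpty.elim, rfl⟩
  have hbase : ∀ d ∈ D, d ⊓ e ∈ R := fun d hd =>
    ⟨WType.mk (Sum.inl (some ⟨d, hd⟩)) PEmpty.elim, rfl⟩
  have hcompl : ∀ r ∈ R, e ⊓ rᶜ ∈ R := by
    rintro _ ⟨w, rfl⟩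
    exact ⟨WType.mk (Sum.inr (Sum.inl PUnit.unit)) (fun _ => w), rfl⟩
  have hsup : ∀ j (f : I j → B), (∀ i, f i ∈ R) → (⨆ i, f i) ∈ R := by
    intro j f hf
    choose w hw using hf
    refine ⟨WType.mk (Sum.inr (Sum.inr j)) w, ?_⟩
    change (⨆ i, ev (w i)) = _
    simp [hw]
  have hle : ∀ r ∈ R, r ≤ e := by
    rintro _ ⟨w, rfl⟩
    induction w with
    | mk a f ih =>
      rcases a with (_ | d) | a | j
      · exact bot_le
      · exact inf_le_right
      · exact inf_le_left
      · exact iSup_le (fun i => ih i)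
  have hsup2 : ∀ (A : Set B), A ⊆ R → (∃ j, #A ≤ #(I j)) → sSup A ∈ R := by
    rintro A hA ⟨j, hj⟩
    obtain ⟨g⟩ := hj
    have : sSup A = ⨆ i : I j, (if h : ∃ x : A, g x = i then (h.choose : B) else ⊥) := by
      apply le_antisymm
      · apply sSup_le
        intro x hx
        refine le_trans ?_ (le_iSup _ (g ⟨x, hx⟩))
        have hex : ∃ y : A, g y = g ⟨x, hx⟩ := ⟨_, rfl⟩
        rw [dif_pos hex]
        have := g.injective hex.choose_spec
        rw [this]
      · apply iSup_le
        intro i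
        split_ifs with h
        · exact le_sSup h.choose.2
        · exact bot_le
    rw [this]
    apply hsup
    intro i
    split_ifs with h
    · exact hA h.choose.2
    · exact hbot
  have hsupb : ∀ a ∈ R, ∀ b ∈ R, a ⊔ b ∈ R := by
    intro a ha b hb
    rw [← sSup_pair]
    apply hsup2
    · rintro x (rfl | rfl) <;> assumption
    · obtain ⟨j⟩ := ‹Nonempty J›
      refine ⟨j, ?_⟩
      have : ({a, b} : Set B).Finite := by simp
      exact (this.lt_aleph0.le).trans (aleph0_le_mk _)
  have hdiff : ∀ a ∈ R, ∀ b ∈ R, a ⊓ bᶜ ∈ R := by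
    intro a ha b hb
    have h1 := hcompl _ (hsupb _ (hcompl a ha) b hb)
    have : e ⊓ (e ⊓ aᶜ ⊔ b)ᶜ = a ⊓ bᶜ := by
      rw [compl_sup, compl_inf, compl_compl, ← inf_assoc, inf_sup_left, inf_compl_eq_bot, bot_sup_eq,
        inf_eq_right.2 (hle a ha)]
    rwa [this] at h1
  have hsS : ∀ S : Set B, S ⊆ R → sSup S ∈ R := by
    intro S hS
    obtain ⟨M, hM1, hM2, hM3⟩ := maxAnti (fun x => x ∈ R ∧ ∃ s ∈ S, x ≤ s)
    have hMR : sSup M ∈ R := by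
      apply hsup2
      · intro m hm
        exact (hM1 m hm).1.1
      · exact hI M (fun a ha => ⟨hle a (hM1 a ha).1.1, (hM1 a ha).2⟩) hM2
    have : sSup S = sSup M := by
      apply le_antisymm
      · apply sSup_le
        intro s hs
        by_contra hcon
        have h0 : s ⊓ (sSup M)ᶜ ≠ ⊥ := by
          intro h0
          apply hcon
          have := le_compl_iff_disjoint_right.2 (disjoint_iff.2 h0)
          simpa using this
        obtain ⟨m, hm, hmm⟩ := hM3 _ ⟨hdiff s (hS hs) _ hMR, s, hs, inf_le_left⟩ h0
        apply hmm
        exact (disjoint_compl_left (a := sSup M)).mono inf_le_right (le_sSup hm)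
      · apply sSup_le
        intro m hm
        obtain ⟨s, hs, hms⟩ := (hM1 m hm).1.2
        exact hms.trans (le_sSup hs)
    rwa [this]
  have hclo : ∀ d, Clo D d → d ⊓ e ∈ R := by
    intro d hd
    induction hd with
    | base d h => exact hbase d h
    | compl d _ ih =>
      have := hcompl _ ih
      have h2 : e ⊓ (d ⊓ e)ᶜ = dᶜ ⊓ e := by
        rw [compl_inf, inf_sup_left, inf_compl_eq_bot, sup_bot_eq, inf_comm]
      rwa [h2] at this
    | sup S _ ih =>
      have h2 : sSup S ⊓ e = sSup ((fun s => s ⊓ e) '' S) := by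
        rw [sSup_inf_eq, sSup_image]
      rw [h2]
      apply hsS
      rintro _ ⟨s, hs, rfl⟩
      exact ih s hs
  have hsub : Iic e ⊆ R := by
    intro y hy
    obtain ⟨d, hd, rfl⟩ := hgen y hy
    exact hclo d hd
  exact (mk_le_mk_of_subset hsub).trans (mk_range_le.trans hW)

theorem sep {J : Type u} {I : J → Type u} {T : Type u} (S : Finset (Σ j, (I j → T))) (j : J) :
    ∃ R : Finset (I j), ∀ f g : I j → T, (⟨j, f⟩ : Σ j, (I j → T)) ∈ S →
      (⟨j, g⟩ : Σ j, (I j → T)) ∈ S → (∀ i ∈ R, f i = g i) → f = g := by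
  classical
  have hfin : {f : I j → T | (⟨j, f⟩ : Σ j, (I j → T)) ∈ S}.Finite :=
    S.finite_toSet.preimage (f := fun f => (⟨j, f⟩ : Σ j, (I j → T))) (by
      intro f _ g _ h
      simpa using h)
  by_cases hne : Nonempty (I j)
  · have : ∀ q : (I j → T) × (I j → T), ∃ i, q.1 ≠ q.2 → q.1 i ≠ q.2 i := by
      intro q
      by_cases h : q.1 = q.2
      · exact ⟨hne.some, fun h' => absurd h h'⟩
      · obtain ⟨i, hi⟩ := Function.ne_iff.1 h
        exact ⟨i, fun _ => hi⟩
    choose w hw using this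
    refine ⟨(hfin.toFinset ×ˢ hfin.toFinset).image w, ?_⟩
    intro f g hf hg h
    by_contra hne
    refine hw (f, g) hne (h _ ?_)
    apply Finset.mem_image_of_mem
    simp only [Finset.mem_product, Finite.mem_toFinset]
    exact ⟨hf, hg⟩
  · rw [not_nonempty_iff] at hne
    exact ⟨∅, fun f g _ _ _ => funext (fun i => hne.elim i)⟩

/-- Mutually independent systems of partitions. -/
def MInd (e : B) {J : Type u} {I : J → Type u} (p : ∀ j, I j → B) : Prop :=
  ∀ (s : Finset J) (c : ∀ j, I j), ∃ y : B, y ≠ ⊥ ∧ y ≤ e ∧ ∀ j ∈ s, y ≤ p j (c j)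

theorem hausdorff (e : B) {J : Type u} {I : J → Type u} [∀ j, Infinite (I j)] (p : ∀ j, I j → B)
    (hp : ∀ j, ∀ i i', i ≠ i' → Disjoint (p j i) (p j i')) (hm : MInd e p) :
    ∃ a : (Σ j, (I j → ULift.{u} Bool)) → B, Ind e a := by
  classical
  have : ∀ j, Nonempty (I j ≃ Finset (I j) × Finset (Finset (I j))) := by
    intro j
    rw [← Cardinal.eq]
    simp
  have ε : ∀ j, I j ≃ Finset (I j) × Finset (Finset (I j)) := fun j => (this j).some
  let tr : ∀ j, (I j → ULift.{u} Bool) → Finset (I j) → Finset (I j) :=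
    fun j f R => R.filter (fun i => f i = ULift.up true)
  let b : (q : Σ j, (I j → ULift.{u} Bool)) → I q.1 → B := fun q i =>
    if tr q.1 q.2 (ε q.1 i).1 ∈ (ε q.1 i).2 then ⊤ else ⊥
  refine ⟨fun q => ⨆ i, p q.1 i ⊓ b q i, ?_⟩
  intro S σ
  choose R hR using sep S
  let F : ∀ j, Finset (Finset (I j)) := fun j =>
    (S.filter σ).biUnion (fun q => if h : q.1 = j then {tr j (h ▸ q.2) (R j)} else ∅)
  obtain ⟨y, hy0, hye, hy⟩ := hm (S.image Sigma.fst) (fun j => (ε j).symm (R j, F j))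
  refine ⟨y, hy0, hye, ?_⟩
  rintro ⟨j, f⟩ hq
  have hyp := hy j (Finset.mem_image.2 ⟨_, hq, rfl⟩)
  obtain ⟨m1, m2⟩ := mix (p j) (b ⟨j, f⟩) (hp j) _ y hyp
  have hb : b ⟨j, f⟩ ((ε j).symm (R j, F j)) = if tr j f (R j) ∈ F j then ⊤ else ⊥ := by
    simp [b]
  have hF : tr j f (R j) ∈ F j ↔ σ ⟨j, f⟩ := by
    constructor
    · intro h
      simp only [F, Finset.mem_biUnion, Finset.mem_filter] at h
      obtain ⟨⟨j', g⟩, ⟨hgS, hgσ⟩, h⟩ := h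
      by_cases hj : j' = j
      · subst hj
        simp only [dite_true, Finset.mem_singleton] at h
        have : f = g := by
          apply hR j' f g hq hgS
          intro i hi
          have h1 : i ∈ tr j' f (R j') ↔ i ∈ tr j' g (R j') := by rw [h]
          simp only [tr, Finset.mem_filter, hi, true_and] at h1
          rcases hf : f i with ⟨⟨⟩⟩ <;> rcases hg : g i with ⟨⟨⟩⟩ <;> simp_all
        rw [this]; exact hgσ
      · simp [hj] at h
    · intro h
      simp only [F, Finset.mem_biUnion, Finset.mem_filter]
      exact ⟨⟨j, f⟩, ⟨hq, h⟩, by simp⟩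
  constructor
  · intro h
    apply m1
    rw [hb, if_pos (hF.2 h)]
    exact le_top
  · intro h
    apply m2
    rw [hb, if_neg (fun h' => h (hF.1 h'))]
    exact disjoint_bot_right

theorem bigInd (e : B) {J : Type u} {I : J → Type u} [∀ j, Infinite (I j)] (p : ∀ j, I j → B)
    (hp : ∀ j, ∀ i i', i ≠ i' → Disjoint (p j i) (p j i')) {K : Type u} [Infinite K]
    (hK : #(Σ j, I j) ≤ #K) (a : K → B)
    (hm : ∀ (s : Finset J) (c : ∀ j, I j) (S : Finset K) (σ : K → Prop), ∃ y : B, y ≠ ⊥ ∧ y ≤ e ∧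
      (∀ j ∈ s, y ≤ p j (c j)) ∧ ∀ k ∈ S, (σ k → y ≤ a k) ∧ (¬ σ k → Disjoint y (a k))) :
    ∃ a : (Σ j, (I j → K)) → B, Ind e a := by
  classical
  have : ∀ j, Nonempty (I j ≃ Finset (I j)) := by
    intro j
    rw [← Cardinal.eq]
    simp
  have ε : ∀ j, I j ≃ Finset (I j) := fun j => (this j).some
  have hcode : #(Σ j, Finset (I j × K)) ≤ #K := by
    have hJ : #J ≤ #K := by
      refine le_trans ?_ hK
      refine mk_le_of_injective (f := fun j => (⟨j, Classical.arbitrary (I j)⟩ : Σ j, I j)) ?_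
      intro j j' h
      simpa using congrArg Sigma.fst h
    have hI : ∀ j, #(I j) ≤ #K := by
      intro j
      refine le_trans ?_ hK
      refine mk_le_of_injective (f := fun i => (⟨j, i⟩ : Σ j, I j)) ?_
      intro j j' h
      simpa using h
    rw [mk_sigma]
    refine (sum_le_sum _ (fun _ => #K) ?_).trans ?_
    · intro j
      rw [mk_finset_of_infinite, mk_prod, lift_id, lift_id]
      exact mul_le_of_le (aleph0_le_mk K) (hI j) le_rfl
    · rw [sum_const']
      exact mul_le_of_le (aleph0_le_mk K) hJ le_rfl
  obtain ⟨code⟩ := hcode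
  let cd : (q : Σ j, (I j → K)) → Finset (I q.1) → K := fun q R =>
    code ⟨q.1, R.image (fun i => (i, q.2 i))⟩
  refine ⟨fun q => ⨆ i, p q.1 i ⊓ a (cd q (ε q.1 i)), ?_⟩
  intro S σ
  choose R hR using sep S
  obtain ⟨y, hy0, hye, hy, hy'⟩ := hm (S.image Sigma.fst) (fun j => (ε j).symm (R j))
    (S.image (fun q => cd q (R q.1))) (fun k => ∃ q ∈ S, cd q (R q.1) = k ∧ σ q)
  refine ⟨y, hy0, hye, ?_⟩
  intro q hq
  have hyp := hy q.1 (Finset.mem_image.2 ⟨_, hq, rfl⟩)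
  obtain ⟨m1, m2⟩ := mix (p q.1) (fun i => a (cd q (ε q.1 i))) (hp q.1) _ y hyp
  simp only [Equiv.apply_symm_apply] at m1 m2
  obtain ⟨n1, n2⟩ := hy' (cd q (R q.1)) (Finset.mem_image_of_mem (fun q => cd q (R q.1)) hq)
  constructor
  · intro h
    exact m1 (n1 ⟨q, hq, rfl, h⟩)
  · intro h
    apply m2
    apply n2
    rintro ⟨q', hq', hcd, hσ⟩
    apply h
    have h1 := code.injective hcd
    obtain ⟨j, f⟩ := q
    obtain ⟨j', g⟩ := q'
    have hj : j' = j := congrArg Sigma.fst h1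
    subst hj
    have h2 : (R j').image (fun i => (i, g i)) = (R j').image (fun i => (i, f i)) := by
      simpa using h1
    have : g = f := by
      apply hR j' g f hq' hq
      intro i hi
      have : (i, g i) ∈ (R j').image (fun i => (i, f i)) := by
        rw [← h2]; exact Finset.mem_image_of_mem (fun i => (i, g i)) hi
      obtain ⟨i', _, he⟩ := Finset.mem_image.1 this
      simp only [Prod.mk.injEq] at he
      obtain ⟨rfl, he⟩ := he
      exact he.symm
    rw [← this]; exact hσ

/-- The cardinal `Σ_j T^{I_j}` absorbs powers `I_k`. -/
theorem card_closed {J : Type u} [LinearOrder J] (I : J → Type u) [∀ j, Infinite (I j)]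
    (hmono : ∀ j j', j ≤ j' → #(I j) ≤ #(I j')) (hIic : ∀ j, #(Iic j) ≤ #(I j))
    (hbd : ∀ k (g : I k → J), ∃ b, ∀ i, g i ≤ b) (T : Type u) (hT : 2 ≤ #T) (k : J) :
    #(Σ j, (I j → T)) ^ #(I k) ≤ #(Σ j, (I j → T)) := by
  classical
  let N : J → Type u := fun b => (I k → Σ j : Iic b, (I j → T))
  have hN : ∀ b, k ≤ b → #(N b) ≤ #(I b → T) := by
    intro b hkb
    have hT0 : #T ≠ 0 := by
      intro h; rw [h] at hT; simp at hT
    have h1 : #(Σ j : Iic b, (I j → T)) ≤ #T ^ #(I b) := by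
      rw [mk_sigma]
      refine (sum_le_sum _ (fun _ => #T ^ #(I b)) ?_).trans ?_
      · rintro ⟨j, hj⟩
        rw [← power_def]
        exact power_le_power_left hT0 (hmono j b hj)
      · rw [sum_const']
        have hlt : #(I b) ≤ #T ^ #(I b) := ((cantor _).le).trans (power_le_power_right hT)
        exact mul_le_of_le ((aleph0_le_mk _).trans hlt) ((hIic b).trans hlt) le_rfl
    have h2 : #(N b) = #(Σ j : Iic b, (I j → T)) ^ #(I k) := by
      rw [power_def]
    rw [h2, ← power_def]
    refine (power_le_power_right h1).trans ?_
    rw [← power_mul]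
    exact power_le_power_left hT0 (mul_le_of_le (aleph0_le_mk _) le_rfl (hmono k b hkb))
  have hsurj : #(I k → Σ j, (I j → T)) ≤ #(Σ b : {b // k ≤ b}, N b) := by
    have : ∀ g : I k → Σ j, (I j → T), ∃ q : (Σ b : {b // k ≤ b}, N b),
        ∀ i, (⟨((q.2 i).1 : J), (q.2 i).2⟩ : Σ j, (I j → T)) = g i := by
      intro g
      obtain ⟨b, hb⟩ := hbd k (fun i => (g i).1)
      refine ⟨⟨⟨max b k, le_max_right _ _⟩, fun i => ⟨⟨(g i).1, (hb i).trans (le_max_left _ _)⟩,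
        (g i).2⟩⟩, fun i => rfl⟩
    choose F hF using this
    refine mk_le_of_injective (f := F) ?_
    intro g g' h
    funext i
    rw [← hF g i, ← hF g' i, h]
  calc #(Σ j, (I j → T)) ^ #(I k) = #(I k → Σ j, (I j → T)) := by rw [power_def]
    _ ≤ #(Σ b : {b // k ≤ b}, N b) := hsurj
    _ ≤ #(Σ b : {b // k ≤ b}, (I b → T)) := by
        rw [mk_sigma, mk_sigma]
        exact sum_le_sum _ _ (fun b => hN b.1 b.2)
    _ ≤ #(Σ j, (I j → T)) := by
        refine mk_le_of_injective
          (f := fun q : (Σ b : {b // k ≤ b}, (I b → T)) => (⟨q.1.1, q.2⟩ : Σ j, (I j → T))) ?_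
        rintro ⟨⟨b, hb⟩, f⟩ ⟨⟨b', hb'⟩, f'⟩ h
        simp only [Sigma.mk.injEq] at h
        obtain ⟨rfl, h⟩ := h
        simp at h
        subst h
        rfl

theorem card_split {X : Type u} {ν : Cardinal.{u}} (hν : ℵ₀ ≤ ν) {W U V : Set X} (hW : ν < #W)
    (hsub : W ⊆ U ∪ V) (hV : #V ≤ ν) : ν < #U := by
  by_contra hcon
  push Not at hcon
  have := (mk_le_mk_of_subset hsub).trans ((mk_union_le U V).trans (add_le_of_le hν hcon hV))
  exact absurd this (not_le.2 hW)

/-- An antichain meeting every element of a small set in many members. -/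
theorem large_anti (E : Set B) (ν : Cardinal.{u}) (hν : ℵ₀ ≤ ν) (hE : #E ≤ ν)
    (h : ∀ x ∈ E, ∃ A : Set B, ν < #A ∧ (∀ a ∈ A, a ≠ ⊥ ∧ a ≤ x) ∧
      ∀ a ∈ A, ∀ b ∈ A, a ≠ b → Disjoint a b) :
    ∃ A : Set B, (∀ a ∈ A, ∀ b ∈ A, a ≠ b → Disjoint a b) ∧
      ∀ x ∈ E, ν < #{z | z ∈ A ∧ ¬ Disjoint x z} := by
  classical
  obtain ⟨r, wo⟩ := exists_wellFoundedLT E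
  have h' : ∀ x : E, ∃ A : Set B, ν < #A ∧ (∀ a ∈ A, a ≠ ⊥ ∧ a ≤ x.1) ∧
      ∀ a ∈ A, ∀ b ∈ A, a ≠ b → Disjoint a b := fun x => h x.1 x.2
  choose A hA1 hA2 hA3 using h'
  let lt : E → E → Prop := r.lt
  have hwf : WellFounded lt := wo.wf
  let T : E → Prop := hwf.fix (fun x ih => ∀ y (hy : lt y x), ih y hy →
    #{z | z ∈ A y ∧ ¬ Disjoint z x.1} ≤ ν)
  have hT : ∀ x, T x ↔ ∀ y, lt y x → T y → #{z | z ∈ A y ∧ ¬ Disjoint z x.1} ≤ ν := by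
    intro x
    have : T x = ∀ y, lt y x → T y → #{z | z ∈ A y ∧ ¬ Disjoint z x.1} ≤ ν := hwf.fix_eq _ _
    rw [this]
  let A' : E → Set B := fun y => {z | z ∈ A y ∧ ∀ x, lt y x → T x → Disjoint z x.1}
  have hsmall : ∀ y, T y → #(A y \ A' y : Set B) ≤ ν := by
    intro y hy
    let G : E → Set B := fun x =>
      if lt y x ∧ T x then {z | z ∈ A y ∧ ¬ Disjoint z x.1} else ∅
    have hsub : A y \ A' y ⊆ ⋃ x, G x := by
      rintro z ⟨hz, hz'⟩
      have : ∃ x, lt y x ∧ T x ∧ ¬ Disjoint z x.1 := by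
        by_contra hcon
        push Not at hcon
        exact hz' ⟨hz, hcon⟩
      obtain ⟨x, h1, h2, h3⟩ := this
      refine mem_iUnion.2 ⟨x, ?_⟩
      simp only [G]
      rw [if_pos ⟨h1, h2⟩]
      exact ⟨hz, h3⟩
    refine (mk_le_mk_of_subset hsub).trans (mk_iUnion_le_sum_mk.trans ?_)
    refine (sum_le_sum _ (fun _ => ν) ?_).trans ?_
    · intro x
      simp only [G]
      split_ifs with hx
      · exact (hT x).1 hx.2 y hx.1 hy
      · simp
    · rw [sum_const']
      exact mul_le_of_le hν hE le_rfl
  refine ⟨{z | ∃ y, T y ∧ z ∈ A' y}, ?_, ?_⟩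
  · have key : ∀ y y' z z', lt y y' → T y' → z ∈ A' y → z' ∈ A' y' → Disjoint z z' := by
      intro y y' z z' hlt hTy hz hz'
      exact (hz.2 y' hlt hTy).mono_right (hA2 y' z' hz'.1).2
    rintro z ⟨y, hy, hz⟩ z' ⟨y', hy', hz'⟩ hne
    rcases @lt_trichotomy _ r y y' with hlt | heq | hlt
    · exact key y y' z z' hlt hy' hz hz'
    · subst heq
      exact hA3 y z hz.1 z' hz'.1 hne
    · exact (key y' y z' z hlt hy hz' hz).symm
  · intro x hx
    by_cases hTx : T ⟨x, hx⟩
    · refine card_split hν (hA1 ⟨x, hx⟩) ?_ (hsmall _ hTx)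
      intro z hz
      by_cases hz' : z ∈ A' ⟨x, hx⟩
      · refine Or.inl ⟨⟨_, hTx, hz'⟩, ?_⟩
        intro hd
        exact (hA2 _ z hz).1 (disjoint_self.1 (hd.mono_left (hA2 _ z hz).2))
      · exact Or.inr ⟨hz, hz'⟩
    · have := hTx
      rw [hT] at this
      push Not at this
      obtain ⟨y, hlt, hTy, hbig⟩ := this
      refine card_split hν hbig ?_ (hsmall y hTy)
      rintro z ⟨hz, hzx⟩
      by_cases hz' : z ∈ A' y
      · exact Or.inl ⟨⟨_, hTy, hz'⟩, fun hd => hzx hd.symm⟩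
      · exact Or.inr ⟨hz, hz'⟩

/-- Homogeneity with respect to saturation. -/
def HomSat (e : B) (θ : Cardinal.{u}) : Prop :=
  (∀ x ≤ e, x ≠ ⊥ → ∀ I : Type u, #I < θ → ∃ q : I → B, (∀ i, q i ≠ ⊥ ∧ q i ≤ x) ∧
    ∀ i i', i ≠ i' → Disjoint (q i) (q i')) ∧
  ∀ A : Set B, (∀ a ∈ A, a ≤ e ∧ a ≠ ⊥) → (∀ a ∈ A, ∀ b ∈ A, a ≠ b → Disjoint a b) → #A < θ

theorem inj_of_disj {I : Type u} {q : I → B} (h0 : ∀ i, q i ≠ ⊥)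
    (hd : ∀ i i', i ≠ i' → Disjoint (q i) (q i')) : Function.Injective q := by
  intro i i' h
  by_contra hne
  have := hd i i' hne
  rw [h] at this
  exact h0 i' (disjoint_self.1 this)

theorem step_part (e : B) (θ : Cardinal.{u}) (hθ : ℵ₀ < θ) (hlim : ∀ ν < θ, Order.succ ν < θ)
    (hom : HomSat e θ) (D : Set B) (hD : #D < θ) (I : Type u) (hI : #I < θ) :
    ∃ p : I → B, (∀ i i', i ≠ i' → Disjoint (p i) (p i')) ∧
      ∀ F : Finset B, (∀ d ∈ F, d ∈ D) → e ⊓ F.inf id ≠ ⊥ → ∀ i, e ⊓ F.inf id ⊓ p i ≠ ⊥ := by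
  classical
  let ν := max ℵ₀ #D
  have hν : ℵ₀ ≤ ν := le_max_left _ _
  have hνθ : ν < θ := max_lt hθ hD
  let E : Set B := {x | x ≠ ⊥ ∧ ∃ F : Finset D, x = e ⊓ (F.image Subtype.val).inf id}
  have hEν : #E ≤ ν := by
    have hsub : E ⊆ range (fun F : Finset D => e ⊓ (F.image Subtype.val).inf id) := by
      rintro x ⟨-, F, rfl⟩
      exact ⟨F, rfl⟩
    refine (mk_le_mk_of_subset hsub).trans (mk_range_le.trans ?_)
    by_cases hinf : Infinite D
    · rw [mk_finset_of_infinite]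
      exact le_max_right _ _
    · rw [not_infinite_iff_finite] at hinf
      exact (lt_aleph0_of_finite _).le.trans hν
  have hEe : ∀ x ∈ E, x ≤ e := by
    rintro x ⟨-, F, rfl⟩
    exact inf_le_left
  obtain ⟨A, hA1, hA2⟩ := large_anti E ν hν hEν (by
    intro x hx
    obtain ⟨q, hq1, hq2⟩ := hom.1 x (hEe x hx) hx.1 (Order.succ ν).out (by
      rw [mk_out]; exact hlim ν hνθ)
    refine ⟨range q, ?_, ?_, ?_⟩
    · rw [mk_range_eq _ (inj_of_disj (fun i => (hq1 i).1) hq2), mk_out]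
      exact Order.lt_succ ν
    · rintro _ ⟨i, rfl⟩
      exact hq1 i
    · rintro _ ⟨i, rfl⟩ _ ⟨i', rfl⟩ hne
      exact hq2 i i' (fun h => hne (by rw [h])))
  obtain ⟨g, hg1, hg2⟩ := inj_choice (E := E) (A := B) (fun x => {z | z ∈ A ∧ ¬ Disjoint x.1 z})
    (fun x => hEν.trans_lt (hA2 x.1 x.2))
  have : ∀ x : E, ∃ q : I → B, (∀ i, q i ≠ ⊥ ∧ q i ≤ x.1 ⊓ g x) ∧
      ∀ i i', i ≠ i' → Disjoint (q i) (q i') := fun x =>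
    hom.1 (x.1 ⊓ g x) (inf_le_left.trans (hEe x.1 x.2))
      (fun h => (hg2 x).2 (disjoint_iff.2 h)) I hI
  choose q hq1 hq2 using this
  refine ⟨fun i => ⨆ x, q x i, ?_, ?_⟩
  · intro i i' hne
    rw [disjoint_iSup_iff]
    intro x'
    rw [iSup_disjoint_iff]
    intro x
    by_cases hx : x = x'
    · subst hx
      exact hq2 x i i' hne
    · have hd : Disjoint (g x) (g x') :=
        hA1 _ (hg2 x).1 _ (hg2 x').1 (fun h => hx (hg1 h))
      exact hd.mono ((hq1 x i).2.trans inf_le_right) ((hq1 x' i').2.trans inf_le_right)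
  · intro F hF hne i h0
    have hxE : e ⊓ F.inf id ∈ E := by
      refine ⟨hne, F.attach.image (fun d => ⟨d.1, hF d.1 d.2⟩), ?_⟩
      congr 2
      ext d
      rw [Finset.mem_image]
      constructor
      · intro hd
        exact ⟨⟨d, hF d hd⟩, Finset.mem_image.2 ⟨⟨d, hd⟩, Finset.mem_attach _ _, rfl⟩, rfl⟩
      · rintro ⟨a, ha, rfl⟩
        obtain ⟨b, -, rfl⟩ := Finset.mem_image.1 ha
        exact b.2
    have h1 := hq1 ⟨_, hxE⟩ i
    apply h1.1
    rw [← le_bot_iff, ← h0]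
    exact le_inf (h1.2.trans inf_le_left) (le_iSup (fun x => q x i) ⟨_, hxE⟩)

theorem exists_sys (e : B) (he : e ≠ ⊥) (θ : Cardinal.{u}) (hθ : ℵ₀ < θ) (hom : HomSat e θ) :
    ∃ (J : Type u) (_ : LinearOrder J) (I : J → Type u) (p : ∀ j, I j → B), Nonempty J ∧
      (∀ j, Infinite (I j)) ∧ (∀ ν < θ, ∃ j, ν ≤ #(I j)) ∧
      (∀ j j', j ≤ j' → #(I j) ≤ #(I j')) ∧ (∀ j, #(Iic j) ≤ #(I j)) ∧
      (∀ k (g : I k → J), ∃ b, ∀ i, g i ≤ b) ∧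
      (∀ j, ∀ i i', i ≠ i' → Disjoint (p j i) (p j i')) ∧ MInd e p := by
  classical
  by_cases hlim : ∀ ν < θ, Order.succ ν < θ
  · obtain ⟨J, lo, wf, hJ, hJ1, hJ2⟩ := exists_wo θ
    let I : J → Type u := fun j => ULift.{u} ℕ ⊕ Iio j
    have hIcard : ∀ j, #(I j) = ℵ₀ + #(Iio j) := by
      intro j
      simp [I]
    have hIθ : ∀ j, #(I j) < θ := by
      intro j
      rw [hIcard]
      exact add_lt_of_lt hθ.le hθ (hJ1 j)
    have hstep : ∀ (j : J) (ih : ∀ i, i < j → I i → B),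
        ∃ p : I j → B, (∀ i i', i ≠ i' → Disjoint (p i) (p i')) ∧
          ∀ F : Finset B, (∀ d ∈ F, ∃ i, ∃ hi : i < j, ∃ t, d = ih i hi t) →
            e ⊓ F.inf id ≠ ⊥ → ∀ i, e ⊓ F.inf id ⊓ p i ≠ ⊥ := by
      intro j ih
      let D : Set B := range (fun q : (Σ i : Iio j, I i) => ih q.1.1 q.1.2 q.2)
      have hD : #D < θ := by
        refine mk_range_le.trans_lt ?_
        rw [mk_sigma]
        refine (sum_le_sum _ (fun _ => #(I j)) ?_).trans_lt ?_
        · rintro ⟨i, hi⟩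
          simp only [hIcard]
          have : #(Iio i) ≤ #(Iio j) := mk_le_mk_of_subset (Iio_subset_Iio (le_of_lt hi))
          gcongr
        · rw [sum_const']
          exact mul_lt_of_lt hθ.le (hJ1 j) (hIθ j)
      obtain ⟨p, hp1, hp2⟩ := step_part e θ hθ hlim hom D hD (I j) (hIθ j)
      refine ⟨p, hp1, fun F hF => hp2 F (fun d hd => ?_)⟩
      obtain ⟨i, hi, t, rfl⟩ := hF d hd
      exact ⟨⟨⟨i, hi⟩, t⟩, rfl⟩
    let p : ∀ j, I j → B := (wellFounded_lt (α := J)).fix (fun j ih => (hstep j ih).choose)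
    have hp : ∀ j, (∀ i i', i ≠ i' → Disjoint (p j i) (p j i')) ∧
          ∀ F : Finset B, (∀ d ∈ F, ∃ i, ∃ _ : i < j, ∃ t, d = p i t) →
            e ⊓ F.inf id ≠ ⊥ → ∀ i, e ⊓ F.inf id ⊓ p j i ≠ ⊥ := by
      intro j
      have : p j = (hstep j (fun i _ => p i)).choose := WellFounded.fix_eq _ _ _
      rw [this]
      exact (hstep j (fun i _ => p i)).choose_spec
    refine ⟨J, lo, I, p, ?_, ?_, ?_, ?_, ?_, ?_, fun j => (hp j).1, ?_⟩
    · rw [← mk_ne_zero_iff, hJ]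
      exact (aleph0_pos.trans hθ).ne'
    · intro j
      exact inferInstanceAs (Infinite (ULift.{u} ℕ ⊕ Iio j))
    · intro ν hν
      obtain ⟨j, hj⟩ := hJ2 ν hν
      refine ⟨j, hj.trans ?_⟩
      rw [hIcard]
      exact self_le_add_left _ _
    · intro j j' hjj
      rw [hIcard, hIcard]
      have : #(Iio j) ≤ #(Iio j') := mk_le_mk_of_subset (Iio_subset_Iio hjj)
      gcongr
    · intro j
      rw [hIcard, ← Iio_insert]
      refine mk_insert_le.trans ?_
      rw [add_comm]
      gcongr
      exact one_le_aleph0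
    · intro k g
      by_contra hcon
      push Not at hcon
      obtain ⟨q, hq1, hq2⟩ := hom.1 e le_rfl he (I k) (hIθ k)
      have : ∀ i, ∃ r : Iio (g i) → B, (∀ t, r t ≠ ⊥ ∧ r t ≤ q i) ∧
          ∀ t t', t ≠ t' → Disjoint (r t) (r t') := fun i =>
        hom.1 (q i) (hq1 i).2 (hq1 i).1 _ (hJ1 _)
      choose r hr1 hr2 using this
      let A : Set B := {z | ∃ i t, z = r i t}
      have hA : #A < θ := by
        apply hom.2
        · rintro _ ⟨i, t, rfl⟩
          exact ⟨(hr1 i t).2.trans (hq1 i).2, (hr1 i t).1⟩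
        · rintro _ ⟨i, t, rfl⟩ _ ⟨i', t', rfl⟩ hne
          by_cases hi : i = i'
          · subst hi
            exact hr2 i t t' (fun h => hne (by rw [h]))
          · exact (hq2 i i' hi).mono (hr1 i t).2 (hr1 i' t').2
      obtain ⟨j, hj⟩ := hJ2 _ (hlim _ hA)
      obtain ⟨i, hi⟩ := hcon j
      have h1 : #(Iio j) ≤ #(Iio (g i)) := mk_le_mk_of_subset (Iio_subset_Iio hi.le)
      have h2 : #(Iio (g i)) ≤ #A := by
        rw [← mk_range_eq _ (inj_of_disj (fun t => (hr1 i t).1) (hr2 i))]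
        apply mk_le_mk_of_subset
        rintro _ ⟨t, rfl⟩
        exact ⟨i, t, rfl⟩
      exact absurd (hj.trans (h1.trans h2)) (not_le.2 (Order.lt_succ _))
    · intro s c
      have key : e ⊓ (s.image (fun j => p j (c j))).inf id ≠ ⊥ := by
        induction s using Finset.induction_on_max with
        | empty => simpa using he
        | insert m s hm ih =>
          have := (hp m).2 (s.image (fun j => p j (c j))) (by
            intro d hd
            obtain ⟨i, hi, rfl⟩ := Finset.mem_image.1 hd
            exact ⟨i, hm i hi, c i, rfl⟩) ih (c m)
          rw [Finset.image_insert, Finset.inf_insert]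
          intro h0
          apply this
          rw [← h0]
          simp only [id]
          rw [inf_assoc, inf_comm (p m (c m))]
      refine ⟨_, key, inf_le_left, ?_⟩
      intro j hj
      exact inf_le_right.trans (Finset.inf_le (f := id) (Finset.mem_image_of_mem _ hj))
  · push Not at hlim
    obtain ⟨ν, hν, hν'⟩ := hlim
    have hνinf : ℵ₀ ≤ ν := by
      by_contra hcon
      push Not at hcon
      have h1 : Order.succ ν ≤ ℵ₀ := Order.succ_le_of_lt hcon
      exact absurd (hν'.trans h1) (not_le.2 hθ)
    obtain ⟨q, hq1, hq2⟩ := hom.1 e le_rfl he ν.out (by rw [mk_out]; exact hν)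
    have hinf : Infinite ν.out := by
      rw [infinite_iff, mk_out]; exact hνinf
    refine ⟨PUnit, inferInstance, fun _ => ν.out, fun _ => q, inferInstance, fun _ => hinf,
      ?_, ?_, ?_, ?_, fun _ => hq2, ?_⟩
    · intro ν' h
      refine ⟨PUnit.unit, ?_⟩
      rw [mk_out]
      exact Order.lt_succ_iff.1 (h.trans_le hν')
    · intros; exact le_rfl
    · intro j
      rw [mk_out]
      exact (lt_aleph0_of_finite _).le.trans hνinf
    · intro k g
      exact ⟨PUnit.unit, fun _ => le_rfl⟩
    · intro s c
      exact ⟨q (c PUnit.unit), (hq1 _).1, (hq1 _).2, fun j _ => le_rfl⟩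


theorem ind_of_le {x : B} {K K' : Type u} (hK : #K' ≤ #K) (h : ∃ a : K → B, Ind x a) :
    ∃ a : K' → B, Ind x a := by
  classical
  obtain ⟨a, ha⟩ := h
  obtain ⟨f⟩ := hK
  refine ⟨a ∘ f, ?_⟩
  intro S σ
  obtain ⟨y, hy0, hyx, hy⟩ := ha (S.image f) (fun k => ∃ k', f k' = k ∧ σ k')
  refine ⟨y, hy0, hyx, fun k hk => ?_⟩
  have := hy (f k) (Finset.mem_image_of_mem _ hk)
  refine ⟨fun h => this.1 ⟨k, rfl, h⟩, fun h => this.2 ?_⟩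
  rintro ⟨k', h1, h2⟩
  rw [f.injective h1] at h2
  exact h h2

/-- `x` carries an independent family as large as possible. -/
def Good (x : B) : Prop := ∃ a : Iic x → B, Ind x a

theorem good_hom (e : B) (he : e ≠ ⊥) (θ : Cardinal.{u}) (hθ : ℵ₀ < θ) (hom : HomSat e θ)
    (D : Set B) (hD : Gen D e) (hmin : ∀ x ≤ e, x ≠ ⊥ → ∀ D' : Set B, #D' < #D → ¬ Gen D' x) :
    Good e := by
  classical
  obtain ⟨J, lo, I, p, hJ, hinf, hcof, hmono, hIic, hbd, hp, hm⟩ := exists_sys e he θ hθ hom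
  have hI : ∀ A : Set B, (∀ a ∈ A, a ≤ e ∧ a ≠ ⊥) →
      (∀ a ∈ A, ∀ b ∈ A, a ≠ b → Disjoint a b) → ∃ j, #A ≤ #(I j) :=
    fun A h1 h2 => hcof _ (hom.2 A h1 h2)
  have hfacts : ∀ T : Type u, 2 ≤ #T → #(Σ j, I j) ≤ #(Σ j, (I j → T)) ∧
      #J ≤ #(Σ j, (I j → T)) ∧ #T ≤ #(Σ j, (I j → T)) := by
    intro T hT
    have hTne : Nonempty T := by
      rw [← mk_ne_zero_iff]
      intro h; rw [h] at hT; simp at hT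
    obtain ⟨t⟩ := hTne
    refine ⟨?_, ?_, ?_⟩
    · rw [mk_sigma, mk_sigma]
      refine sum_le_sum _ _ (fun j => ?_)
      rw [← power_def]
      exact (cantor _).le.trans (power_le_power_right hT)
    · exact mk_le_of_injective (f := fun j => (⟨j, fun _ => t⟩ : Σ j, (I j → T)))
        (fun j j' h => (Sigma.mk.inj h).1)
    · obtain ⟨j⟩ := hJ
      have : Nonempty (I j) := inferInstance
      obtain ⟨i⟩ := this
      refine mk_le_of_injective (f := fun t => (⟨j, fun _ => t⟩ : Σ j, (I j → T))) ?_
      intro t t' h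
      have h2 := (Sigma.mk.inj h).2
      exact congrFun (eq_of_heq h2) i
  have hminf : ℵ₀ ≤ #(Σ j, I j) := by
    obtain ⟨j⟩ := hJ
    refine (infinite_iff.1 (hinf j)).trans ?_
    exact mk_le_of_injective (f := fun i => (⟨j, i⟩ : Σ j, I j)) (fun i i' h => by simpa using h)
  by_cases hτ : #D ≤ #(Σ j, I j)
  · have hT : (2 : Cardinal.{u}) ≤ #(ULift.{u} Bool) := by simp
    obtain ⟨h1, h2, h3⟩ := hfacts _ hT
    refine ind_of_le ?_ (hausdorff e p hp hm)
    exact clo_card D e J I hI _ (hminf.trans h1) h2 (hτ.trans h1)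
      (card_closed I hmono hIic hbd _ hT) hD
  · push Not at hτ
    obtain ⟨K, loK, wfK, hKc, hK1, -⟩ := exists_wo #D
    have hDinf : ℵ₀ ≤ #D := hminf.trans hτ.le
    have hKinf : Infinite K := by rw [infinite_iff, hKc]; exact hDinf
    have hT : (2 : Cardinal.{u}) ≤ #K := by
      rw [hKc]; exact (natCast_lt_aleph0 (n := 2)).le.trans hDinf
    let D0 : Set B := range (fun q : Σ j, I j => p q.1 q.2)
    have hD0 : #D0 < #D := mk_range_le.trans_lt hτ
    have hstep : ∀ (k : K) (ih : ∀ i, i < k → B), ∃ a : B,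
        ∀ d, Clo (D0 ∪ range (fun i : Iio k => ih i.1 i.2)) d → d ⊓ e ≠ ⊥ →
          d ⊓ e ⊓ a ≠ ⊥ ∧ d ⊓ e ⊓ aᶜ ≠ ⊥ := by
      intro k ih
      apply vladimirov
      intro x hx hx0
      refine hmin x hx hx0 _ ?_
      exact (mk_union_le _ _).trans_lt
        (add_lt_of_lt hDinf hD0 (mk_range_le.trans_lt (hK1 k)))
    let a : K → B := (wellFounded_lt (α := K)).fix (fun k ih => (hstep k ih).choose)
    have ha : ∀ k d, Clo (D0 ∪ range (fun i : Iio k => a i.1)) d → d ⊓ e ≠ ⊥ →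
          d ⊓ e ⊓ a k ≠ ⊥ ∧ d ⊓ e ⊓ (a k)ᶜ ≠ ⊥ := by
      intro k
      have : a k = (hstep k (fun i _ => a i)).choose := WellFounded.fix_eq _ _ _
      rw [this]
      exact (hstep k (fun i _ => a i)).choose_spec
    have key : ∀ (d : B), Clo D0 d → d ⊓ e ≠ ⊥ → ∀ (σ : K → Prop) (S : Finset K),
        ∃ y, Clo (D0 ∪ a '' (S : Set K)) y ∧ y ≤ d ∧ y ⊓ e ≠ ⊥ ∧
          ∀ k ∈ S, (σ k → y ≤ a k) ∧ (¬ σ k → Disjoint y (a k)) := by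
      intro d hd hde σ S
      induction S using Finset.induction_on_max with
      | empty => exact ⟨d, hd.mono subset_union_left, le_rfl, hde, by simp⟩
      | insert m S hmS ih =>
        obtain ⟨y, hy1, hy2, hy3, hy4⟩ := ih
        have hy1' : Clo (D0 ∪ range (fun i : Iio m => a i.1)) y := by
          refine hy1.mono (union_subset_union_right _ ?_)
          rintro _ ⟨i, hi, rfl⟩
          exact ⟨⟨i, hmS i hi⟩, rfl⟩
        have hyc : Clo (D0 ∪ a '' ((insert m S : Finset K) : Set K)) y := by
          refine hy1.mono (union_subset_union_right _ (image_mono ?_))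
          simp
        have hmc : Clo (D0 ∪ a '' ((insert m S : Finset K) : Set K)) (a m) :=
          Clo.base _ (Or.inr ⟨m, by simp, rfl⟩)
        obtain ⟨h1, h2⟩ := ha m y hy1' hy3
        by_cases hσ : σ m
        · refine ⟨y ⊓ a m, hyc.inf hmc, inf_le_left.trans hy2, ?_, ?_⟩
          · rw [inf_right_comm]; exact h1
          · intro k hk
            rcases Finset.mem_insert.1 hk with rfl | hk
            · exact ⟨fun _ => inf_le_right, fun h => absurd hσ h⟩
            · exact ⟨fun h => inf_le_left.trans ((hy4 k hk).1 h),
                fun h => ((hy4 k hk).2 h).mono_left inf_le_left⟩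
        · refine ⟨y ⊓ (a m)ᶜ, hyc.inf (hmc.compl), inf_le_left.trans hy2, ?_, ?_⟩
          · rw [inf_right_comm]; exact h2
          · intro k hk
            rcases Finset.mem_insert.1 hk with rfl | hk
            · exact ⟨fun h => absurd h hσ,
                fun _ => disjoint_compl_left.mono_left inf_le_right⟩
            · exact ⟨fun h => inf_le_left.trans ((hy4 k hk).1 h),
                fun h => ((hy4 k hk).2 h).mono_left inf_le_left⟩
    obtain ⟨h1, h2, h3⟩ := hfacts K hT
    refine ind_of_le ?_ (bigInd e p hp (K := K) (by rw [hKc]; exact hτ.le) a ?_)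
    · exact clo_card D e J I hI _ (hminf.trans h1) h2 (by rw [hKc] at h3; exact h3)
        (card_closed I hmono hIic hbd _ hT) hD
    · intro s c S σ
      obtain ⟨y0, hy0, hy0e, hy0p⟩ := hm s c
      let d : B := sInf ((fun j => p j (c j)) '' (s : Set J))
      have hd : Clo D0 d := by
        apply Clo.inf'
        rintro _ ⟨j, hj, rfl⟩
        exact Clo.base _ ⟨⟨j, c j⟩, rfl⟩
      have hde : d ⊓ e ≠ ⊥ := by
        intro h
        apply hy0
        rw [← le_bot_iff, ← h]
        refine le_inf (le_sInf ?_) hy0e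
        rintro _ ⟨j, hj, rfl⟩
        exact hy0p j hj
      obtain ⟨y, -, hyd, hye, hyS⟩ := key d hd hde σ S
      refine ⟨y ⊓ e, hye, inf_le_right, ?_, ?_⟩
      · intro j hj
        exact inf_le_left.trans (hyd.trans (sInf_le ⟨j, hj, rfl⟩))
      · intro k hk
        exact ⟨fun h => inf_le_left.trans ((hyS k hk).1 h),
          fun h => ((hyS k hk).2 h).mono_left inf_le_left⟩

def Atomless (x : B) : Prop := ∀ y ≤ x, y ≠ ⊥ → ∃ z, z < y ∧ z ≠ ⊥

def Sat (x : B) (θ : Cardinal.{u}) : Prop :=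
  ∀ A : Set B, (∀ a ∈ A, a ≤ x ∧ a ≠ ⊥) → (∀ a ∈ A, ∀ b ∈ A, a ≠ b → Disjoint a b) → #A < θ

theorem atomless_anti (x : B) (hx : x ≠ ⊥) (hat : Atomless x) :
    ∃ A : Set B, (∀ a ∈ A, a ≤ x ∧ a ≠ ⊥) ∧ (∀ a ∈ A, ∀ b ∈ A, a ≠ b → Disjoint a b) ∧
      ℵ₀ ≤ #A := by
  classical
  have : ∀ y : {y : B // y ≤ x ∧ y ≠ ⊥}, ∃ z : {y : B // y ≤ x ∧ y ≠ ⊥}, z.1 < y.1 := by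
    rintro ⟨y, hy, hy0⟩
    obtain ⟨z, hz, hz0⟩ := hat y hy hy0
    exact ⟨⟨z, hz.le.trans hy, hz0⟩, hz⟩
  choose g hg using this
  let f : ℕ → {y : B // y ≤ x ∧ y ≠ ⊥} := fun n => g^[n] ⟨x, le_rfl, hx⟩
  have hf : ∀ n, (f (n+1)).1 < (f n).1 := by
    intro n
    simp only [f, Function.iterate_succ_apply']
    exact hg _
  have hanti : Antitone (fun n => (f n).1) := antitone_nat_of_succ_le (fun n => (hf n).le)
  let d : ℕ → B := fun n => (f n).1 \ (f (n+1)).1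
  have hd0 : ∀ n, d n ≠ ⊥ := by
    intro n h
    have := sdiff_eq_bot_iff.1 h
    exact absurd this (not_le_of_gt (hf n))
  have hdd : ∀ n m, n < m → Disjoint (d n) (d m) := by
    intro n m hnm
    have h1 : d m ≤ (f (n+1)).1 := sdiff_le.trans (hanti (Nat.succ_le_of_lt hnm))
    exact disjoint_sdiff_self_left.mono_right h1
  have hdd' : ∀ n m, n ≠ m → Disjoint (d n) (d m) := by
    intro n m hnm
    rcases lt_or_gt_of_ne hnm with h | h
    · exact hdd n m h
    · exact (hdd m n h).symm
  have hinj : Function.Injective d := by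
    intro n m h
    by_contra hne
    have := hdd' n m hne
    rw [h] at this
    exact hd0 m (disjoint_self.1 this)
  refine ⟨range d, ?_, ?_, ?_⟩
  · rintro _ ⟨n, rfl⟩
    exact ⟨sdiff_le.trans (f n).2.1, hd0 n⟩
  · rintro _ ⟨n, rfl⟩ _ ⟨m, rfl⟩ hne
    exact hdd' n m (fun h => hne (by rw [h]))
  · have := infinite_range_of_injective hinj
    exact infinite_iff.1 this.to_subtype

theorem exists_good (x : B) (hx : x ≠ ⊥) (hat : Atomless x) : ∃ e ≤ x, e ≠ ⊥ ∧ Good e := by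
  classical
  let sat : B → Cardinal.{u} := fun y => sInf {θ | Sat y θ}
  have hsat : ∀ y, Sat y (sat y) := by
    intro y
    have hne : {θ | Sat y θ}.Nonempty := by
      refine ⟨Order.succ #B, fun A _ _ => ?_⟩
      exact Order.lt_succ_of_le (mk_set_le A)
    exact csInf_mem hne
  let tau : B → Cardinal.{u} := fun y => sInf {c | ∃ D : Set B, #D = c ∧ Gen D y}
  have htau : ∀ y, ∃ D : Set B, #D = tau y ∧ Gen D y := by
    intro y
    have hne : {c | ∃ D : Set B, #D = c ∧ Gen D y}.Nonempty := by
      refine ⟨_, univ, rfl, fun z hz => ⟨z, Clo.base _ (mem_univ _), ?_⟩⟩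
      exact (inf_eq_left.2 hz).symm
    exact csInf_mem hne
  obtain ⟨e1, ⟨he1x, he10⟩, hmin1⟩ := (InvImage.wf sat (wellFounded_lt (α := Cardinal.{u}))).has_min
    {y | y ≤ x ∧ y ≠ ⊥} ⟨x, le_rfl, hx⟩
  obtain ⟨e, ⟨hee1, he0⟩, hmin2⟩ := (InvImage.wf tau (wellFounded_lt (α := Cardinal.{u}))).has_min
    {y | y ≤ e1 ∧ y ≠ ⊥} ⟨e1, le_rfl, he10⟩
  obtain ⟨D, hD1, hD2⟩ := htau e
  refine ⟨e, hee1.trans he1x, he0, good_hom e he0 (sat e1) ?_ ⟨?_, ?_⟩ D hD2 ?_⟩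
  · obtain ⟨A, h1, h2, h3⟩ := atomless_anti e1 he10 (fun y hy => hat y (hy.trans he1x))
    exact h3.trans_lt (hsat e1 A h1 h2)
  · intro y hy hy0 I hI
    have h1 : sat e1 ≤ sat y := not_lt.1 (hmin1 y ⟨hy.trans (hee1.trans he1x), hy0⟩)
    have h2 : ¬ Sat y #I := fun h => absurd (hI.trans_le (h1.trans (csInf_le' h))) (lt_irrefl _)
    unfold Sat at h2
    push Not at h2
    obtain ⟨A, hA1, hA2, hA3⟩ := h2
    obtain ⟨f⟩ := hA3
    refine ⟨fun i => (f i).1, fun i => ⟨(hA1 _ (f i).2).2, (hA1 _ (f i).2).1⟩, ?_⟩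
    intro i i' hne
    exact hA2 _ (f i).2 _ (f i').2 (fun h => hne (f.injective (Subtype.ext h)))
  · intro A h1 h2
    exact hsat e1 A (fun a ha => ⟨(h1 a ha).1.trans hee1, (h1 a ha).2⟩) h2
  · intro y hy hy0 D' hD' hG
    have h1 : tau e ≤ tau y := not_lt.1 (hmin2 y ⟨hy.trans hee1, hy0⟩)
    have h2 : tau y ≤ #D' := csInf_le' ⟨D', rfl, hG⟩
    rw [hD1] at hD'
    exact absurd (hD'.trans_le (h1.trans h2)) (lt_irrefl _)

theorem N_mono {z w : B} (h : z ≤ w) : #(Iic z) ≤ #(Iic w) :=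
  mk_le_mk_of_subset (Iic_subset_Iic.2 h)

theorem N_sup (z w : B) : #(Iic (z ⊔ w)) ≤ #(Iic z) * #(Iic w) := by
  rw [mul_def]
  refine mk_le_of_injective (f := fun y : Iic (z ⊔ w) =>
    ((⟨y.1 ⊓ z, inf_le_right⟩, ⟨y.1 ⊓ w, inf_le_right⟩) : Iic z × Iic w)) ?_
  rintro ⟨y, hy⟩ ⟨y', hy'⟩ h
  have h1 : y ⊓ z = y' ⊓ z := congrArg Subtype.val (congrArg Prod.fst h)
  have h2 : y ⊓ w = y' ⊓ w := congrArg Subtype.val (congrArg Prod.snd h)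
  apply Subtype.ext
  change y = y'
  rw [← inf_eq_left.2 hy, ← inf_eq_left.2 hy', inf_sup_left, inf_sup_left, h1, h2]

theorem N_ne_bot {z w : B} (h : #(Iic w) ≤ #(Iic z)) (hw : w ≠ ⊥) : z ≠ ⊥ := by
  rintro rfl
  have h1 : #(Iic (⊥ : B)) ≤ 1 := by
    rw [le_one_iff_subsingleton]
    refine ⟨?_⟩
    rintro ⟨a, ha⟩ ⟨b, hb⟩
    apply Subtype.ext
    change a = b
    rw [le_bot_iff.1 ha, le_bot_iff.1 hb]
  have h2 := le_one_iff_subsingleton.1 (h.trans h1)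
  have := h2.elim ⟨w, le_rfl⟩ ⟨⊥, bot_le⟩
  exact hw (congrArg Subtype.val this)

theorem prod_good (x : B) (κ : Cardinal.{u}) (hκ : #(Iic x) = κ) (hinf : ℵ₀ ≤ κ)
    {ι : Type u} [LinearOrder ι] [WellFoundedLT ι] (hι : ∀ k : ι, #(Iio k) < #ι)
    (p : ι → B) (hp : ∀ i j, i ≠ j → Disjoint (p i) (p j)) (hpx : ∀ i, p i ≤ x)
    (hpκ : ∀ i, #(Iic (p i)) < κ) (hsup : κ ≤ #(Iic (⨆ i, p i)))
    (hmin : ∀ (ι' : Type u) (p' : ι' → B), #ι' < #ι → (∀ i j, i ≠ j → Disjoint (p' i) (p' j)) →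
      (∀ i, p' i ≤ x) → (∀ i, #(Iic (p' i)) < κ) → #(Iic (⨆ i, p' i)) < κ)
    (IH : ∀ z ≤ x, z ≠ ⊥ → #(Iic z) < κ → Good z) : Good x := by
  classical
  -- initial segments are small
  have F1 : ∀ β, #(Iic (⨆ γ : Iio β, p γ)) < κ := fun β =>
    hmin (Iio β) (fun γ => p γ) (hι β) (fun i j h => hp i j (fun h' => h (Subtype.ext h')))
      (fun i => hpx i) (fun i => hpκ i)
  have hne : Nonempty ι := by
    by_contra hcon
    rw [not_nonempty_iff] at hcon
    have h1 : (⨆ i, p i) = ⊥ := iSup_of_empty p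
    have h2 : #(Iic (⊥ : B)) ≤ 1 := by
      rw [le_one_iff_subsingleton]
      refine ⟨?_⟩
      rintro ⟨a, ha⟩ ⟨b, hb⟩
      apply Subtype.ext
      change a = b
      rw [le_bot_iff.1 ha, le_bot_iff.1 hb]
    rw [h1] at hsup
    exact absurd (hinf.trans (hsup.trans h2)) (not_le.2 one_lt_aleph0)
  let q : ι → ι → B := fun α β => ⨆ γ : Ico α β, p γ
  have hqx : ∀ α β, q α β ≤ x := fun α β => iSup_le fun γ => hpx γ
  have hqle : ∀ α β γ, α ≤ γ → γ < β → p γ ≤ q α β := fun α β γ h1 h2 =>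
    le_iSup (fun γ : Ico α β => p γ) ⟨γ, h1, h2⟩
  have hqκ : ∀ α β, #(Iic (q α β)) < κ := by
    intro α β
    refine (N_mono ?_).trans_lt (F1 β)
    exact iSup_le fun γ => le_iSup (fun γ : Iio β => p γ) ⟨γ.1, γ.2.2⟩
  have hqd : ∀ α β α' β', β ≤ α' → Disjoint (q α β) (q α' β') := by
    intro α β α' β' h
    rw [disjoint_iSup_iff]
    intro γ'
    rw [iSup_disjoint_iff]
    intro γ
    exact hp _ _ (ne_of_lt (γ.2.2.trans_le (h.trans γ'.2.1)))
  have F2 : ∀ β : ι, ∃ γ, β < γ := by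
    intro β
    by_contra hcon
    push Not at hcon
    have h1 : (⨆ i, p i) ≤ (⨆ γ : Iio β, p γ) ⊔ p β := by
      refine iSup_le fun i => ?_
      rcases (hcon i).lt_or_eq with h | h
      · exact le_sup_of_le_left (le_iSup (fun γ : Iio β => p γ) ⟨i, h⟩)
      · rw [h]; exact le_sup_right
    have h2 := (N_mono h1).trans (N_sup _ _)
    exact absurd (hsup.trans h2) (not_le.2 (mul_lt_of_lt hinf (F1 β) (hpκ β)))
  have F3 : ∀ (ξ : ι) (g : Iio ξ → ι), ∃ b, ∀ η, g η ≤ b := by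
    intro ξ g
    by_contra hcon
    push Not at hcon
    choose h hh using hcon
    have := hmin (Iio ξ) (fun η => ⨆ γ : {γ // h γ = η}, p γ) (hι ξ) (by
      intro η η' hne'
      rw [disjoint_iSup_iff]
      intro γ'
      rw [iSup_disjoint_iff]
      intro γ
      apply hp
      intro heq
      apply hne'
      rw [← γ.2, ← γ'.2, heq]) (fun η => iSup_le fun γ => hpx γ) (by
      intro η
      refine (N_mono ?_).trans_lt (F1 (g η))
      refine iSup_le fun γ => le_iSup (fun γ : Iio (g η) => p γ) ⟨γ.1, ?_⟩
      have := hh γ.1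
      rw [γ.2] at this
      exact this)
    have h1 : (⨆ i, p i) ≤ ⨆ η : Iio ξ, ⨆ γ : {γ // h γ = η}, p γ := by
      refine iSup_le fun i => ?_
      refine le_iSup_of_le (h i) ?_
      exact le_iSup (fun γ : {γ // h γ = h i} => p γ) ⟨i, rfl⟩
    exact absurd (hsup.trans (N_mono h1)) (not_le.2 this)
  have F4 : ∃ α0, ∀ β ≥ α0, ∃ γ ≥ β, #(Iic (q α0 β)) ≤ #(Iic (q β γ)) := by
    by_contra hcon
    push Not at hcon
    obtain ⟨α⟩ := hne
    obtain ⟨β, hβ, hβ'⟩ := hcon α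
    obtain ⟨⟨a, b⟩, h1, h2⟩ := (InvImage.wf (fun t : ι × ι => #(Iic (q t.1 t.2)))
      (wellFounded_lt (α := Cardinal.{u}))).has_min
      {t | ∀ γ ≥ t.2, #(Iic (q t.2 γ)) < #(Iic (q t.1 t.2))} ⟨(α, β), hβ'⟩
    obtain ⟨c, hc, hc'⟩ := hcon b
    exact h2 (b, c) hc' (h1 c hc)
  obtain ⟨α0, hα0⟩ := F4
  let r : B := ⨆ γ : Ici α0, p γ
  have hrx : r ≤ x := iSup_le fun γ => hpx γ
  have hr : κ ≤ #(Iic r) := by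
    by_contra hcon
    push Not at hcon
    have h1 : (⨆ i, p i) ≤ (⨆ γ : Iio α0, p γ) ⊔ r := by
      refine iSup_le fun i => ?_
      rcases lt_or_ge i α0 with h | h
      · exact le_sup_of_le_left (le_iSup (fun γ : Iio α0 => p γ) ⟨i, h⟩)
      · exact le_sup_of_le_right (le_iSup (fun γ : Ici α0 => p γ) ⟨i, h⟩)
    have h2 := (N_mono h1).trans (N_sup _ _)
    exact absurd (hsup.trans h2) (not_le.2 (mul_lt_of_lt hinf (F1 α0) hcon))
  have hr0 : r ≠ ⊥ := by
    have : r ≠ ⊥ := by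
      intro h0
      have h2 : #(Iic r) ≤ 1 := by
        rw [h0, le_one_iff_subsingleton]
        refine ⟨?_⟩
        rintro ⟨a, ha⟩ ⟨b, hb⟩
        apply Subtype.ext
        change a = b
        rw [le_bot_iff.1 ha, le_bot_iff.1 hb]
      exact absurd (hinf.trans (hr.trans h2)) (not_le.2 one_lt_aleph0)
    exact this
  -- the blocks
  have hstep : ∀ (ξ : ι) (ih : ∀ η, η < ξ → ι × ι), ∃ t : ι × ι, ξ < t.1 ∧
      (∀ η (h : η < ξ), (ih η h).2 ≤ t.1) ∧ #(Iic (q α0 t.1)) ≤ #(Iic (q t.1 t.2)) := by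
    intro ξ ih
    obtain ⟨b, hb⟩ := F3 ξ (fun η => (ih η.1 η.2).2)
    obtain ⟨s, hs⟩ := F2 ξ
    obtain ⟨γ, -, hγ⟩ := hα0 (max s (max α0 b)) (by simp)
    refine ⟨(max s (max α0 b), γ), lt_of_lt_of_le hs (le_max_left _ _), ?_, hγ⟩
    intro η h
    exact (hb ⟨η, h⟩).trans ((le_max_right α0 b).trans (le_max_right _ _))
  let t : ι → ι × ι := (wellFounded_lt (α := ι)).fix (fun k ih => (hstep k ih).choose)
  have ht : ∀ ξ, ξ < (t ξ).1 ∧ (∀ η (_ : η < ξ), (t η).2 ≤ (t ξ).1) ∧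
      #(Iic (q α0 (t ξ).1)) ≤ #(Iic (q (t ξ).1 (t ξ).2)) := by
    intro k
    have : t k = (hstep k (fun i _ => t i)).choose := WellFounded.fix_eq _ _ _
    rw [this]
    exact (hstep k (fun i _ => t i)).choose_spec
  let Q : ι → B := fun ξ => q (t ξ).1 (t ξ).2
  have hQ : ∀ i j, i ≠ j → Disjoint (Q i) (Q j) := by
    intro i j hij
    rcases lt_or_gt_of_ne hij with h | h
    · exact hqd _ _ _ _ ((ht j).2.1 i h)
    · exact (hqd _ _ _ _ ((ht i).2.1 j h)).symm
  have ha : ∀ ξ, ∃ a : Iic (Q ξ) → B, Q ξ ≠ ⊥ → Ind (Q ξ) a := by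
    intro ξ
    by_cases h : Q ξ = ⊥
    · exact ⟨fun _ => ⊥, fun h' => absurd h h'⟩
    · obtain ⟨a, ha⟩ := IH (Q ξ) (hqx _ _) h (hqκ _ _)
      exact ⟨a, fun _ => ha⟩
  choose a ha using ha
  have hh : ∀ ξ, Nonempty (Iic (q α0 (t ξ).1) ↪ Iic (Q ξ)) := fun ξ => (ht ξ).2.2
  let h : ∀ ξ, Iic (q α0 (t ξ).1) ↪ Iic (Q ξ) := fun ξ => (hh ξ).some
  let code : ∀ ξ, B → Iic (Q ξ) := fun ξ z => h ξ ⟨z ⊓ q α0 (t ξ).1, inf_le_right⟩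
  have hcode : ∀ ξ z w, code ξ z = code ξ w → z ⊓ q α0 (t ξ).1 = w ⊓ q α0 (t ξ).1 := by
    intro ξ z w hzw
    exact congrArg Subtype.val ((h ξ).injective hzw)
  have hsep : ∀ z w : B, ∃ γ : ι, z ≤ r → w ≤ r → z ≠ w → α0 ≤ γ ∧ z ⊓ p γ ≠ w ⊓ p γ := by
    intro z w
    by_cases hcon : ∃ γ : ι, α0 ≤ γ ∧ z ⊓ p γ ≠ w ⊓ p γ
    · obtain ⟨γ, hγ⟩ := hcon
      exact ⟨γ, fun _ _ _ => hγ⟩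
    · push Not at hcon
      refine ⟨α0, fun hz hw hzw => absurd ?_ hzw⟩
      rw [← inf_eq_left.2 hz, ← inf_eq_left.2 hw, inf_iSup_eq, inf_iSup_eq]
      exact iSup_congr fun γ => hcon γ.1 γ.2
  choose g hg using hsep
  have hlarge : ∀ S : Finset B, (∀ z ∈ S, z ≤ r) → ∃ ξ, ∀ z ∈ S, ∀ w ∈ S,
      z ⊓ q α0 (t ξ).1 = w ⊓ q α0 (t ξ).1 → z = w := by
    intro S hS
    obtain ⟨ξ, hξ⟩ := Finset.exists_le ((S ×ˢ S).image (fun u => g u.1 u.2))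
    refine ⟨ξ, fun z hz w hw heq => ?_⟩
    by_contra hzw
    obtain ⟨h1, h2⟩ := hg z w (hS z hz) (hS w hw) hzw
    have h3 : g z w ≤ ξ := hξ _ (Finset.mem_image.2 ⟨(z, w), by simp [hz, hw], rfl⟩)
    have h4 := hqle α0 (t ξ).1 (g z w) h1 (h3.trans_lt (ht ξ).1)
    apply h2
    rw [← inf_eq_right.2 h4, ← inf_assoc, ← inf_assoc, heq]
  refine ind_of_le (K := Iic r) (by rw [hκ]; exact hr)
    ⟨fun z => ⨆ ξ, Q ξ ⊓ a ξ (code ξ z.1), ?_⟩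
  intro S σ
  obtain ⟨ξ, hξ⟩ := hlarge (insert ⊥ (insert r (S.image Subtype.val))) (by
    intro z hz
    simp only [Finset.mem_insert, Finset.mem_image] at hz
    rcases hz with rfl | rfl | ⟨z, -, rfl⟩
    · exact bot_le
    · exact le_rfl
    · exact z.2)
  have hq0 : q α0 (t ξ).1 ≠ ⊥ := by
    intro h0
    apply hr0
    apply hξ r (by simp) ⊥ (by simp)
    rw [h0, inf_bot_eq, inf_bot_eq]
  have hQ0 : Q ξ ≠ ⊥ := N_ne_bot (ht ξ).2.2 hq0
  obtain ⟨y, hy0, hyQ, hy⟩ := ha ξ hQ0 (S.image (fun z => code ξ z.1))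
    (fun k => ∃ z ∈ S, code ξ z.1 = k ∧ σ z)
  refine ⟨y, hy0, hyQ.trans (hqx _ _), fun z hz => ?_⟩
  have h1 := hy (code ξ z.1) (Finset.mem_image.2 ⟨z, hz, rfl⟩)
  have h2 := mix Q (fun ξ => a ξ (code ξ z.1)) hQ ξ y hyQ
  refine ⟨fun hσ => h2.1 (h1.1 ⟨z, hz, rfl, hσ⟩), fun hσ => h2.2 (h1.2 ?_)⟩
  rintro ⟨w, hw, hwz, hσw⟩
  have : w.1 = z.1 := hξ w.1 (by simp only [Finset.mem_insert, Finset.mem_image]; exact Or.inr (Or.inr ⟨w, hw, rfl⟩))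
    z.1 (by simp only [Finset.mem_insert, Finset.mem_image]; exact Or.inr (Or.inr ⟨z, hz, rfl⟩)) (hcode ξ _ _ hwz)
  rw [Subtype.ext this] at hσw
  exact hσ hσw

theorem good_atomless (κ : Cardinal.{u}) : ∀ x : B, x ≠ ⊥ → Atomless x → #(Iic x) = κ → Good x := by
  classical
  induction κ using WellFoundedLT.induction with
  | ind κ IH =>
  intro x hx hat hκ
  have hinf : ℵ₀ ≤ κ := by
    obtain ⟨A, h1, -, h3⟩ := atomless_anti x hx hat
    rw [← hκ]
    exact h3.trans (mk_le_mk_of_subset (fun a ha => (h1 a ha).1))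
  have IH' : ∀ z ≤ x, z ≠ ⊥ → #(Iic z) < κ → Good z := fun z hz hz0 hzκ =>
    IH _ hzκ z hz0 (fun y hy => hat y (hy.trans hz)) rfl
  by_cases hex : ∃ e ≤ x, Good e ∧ #(Iic e) = κ
  · obtain ⟨e, hex, ⟨a, ha⟩, heκ⟩ := hex
    refine ind_of_le (K := Iic e) (by rw [hκ, heκ]) ⟨a, ?_⟩
    intro S σ
    obtain ⟨y, h1, h2, h3⟩ := ha S σ
    exact ⟨y, h1, h2.trans hex, h3⟩
  · push Not at hex
    let C : Set Cardinal.{u} := {c | ∃ (ι : Type u) (p : ι → B), #ι = c ∧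
      (∀ i j, i ≠ j → Disjoint (p i) (p j)) ∧ (∀ i, p i ≤ x) ∧ (∀ i, #(Iic (p i)) < κ) ∧
      κ ≤ #(Iic (⨆ i, p i))}
    have hC : C.Nonempty := by
      obtain ⟨M, hM1, hM2, hM3⟩ := maxAnti (fun z : B => z ≤ x ∧ #(Iic z) < κ)
      have hle : x ≤ sSup M := by
        by_contra hcon
        have hne : x \ sSup M ≠ ⊥ := fun h => hcon (sdiff_eq_bot_iff.1 h)
        obtain ⟨e, he, he0, heg⟩ := exists_good (x \ sSup M) hne
          (fun y hy => hat y (hy.trans sdiff_le))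
        have hex' : e ≤ x := he.trans sdiff_le
        have hlt : #(Iic e) < κ := lt_of_le_of_ne (by rw [← hκ]; exact N_mono hex')
          (hex e hex' heg)
        obtain ⟨m, hm, hd⟩ := hM3 e ⟨hex', hlt⟩ he0
        exact hd ((disjoint_sdiff_self_left.mono_left he).mono_right (le_sSup hm))
      refine ⟨#M, M, Subtype.val, rfl, ?_, fun i => (hM1 i.1 i.2).1.1,
        fun i => (hM1 i.1 i.2).1.2, ?_⟩
      · intro i j hij
        exact hM2 i.1 i.2 j.1 j.2 (fun h => hij (Subtype.ext h))
      · rw [← sSup_eq_iSup', ← hκ]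
        exact N_mono hle
    obtain ⟨ι0, p0, hc0, hd0, hx0, hκ0, hs0⟩ := csInf_mem hC
    obtain ⟨ι, lo, wf, hι, hι1, -⟩ := exists_wo (sInf C)
    have heq : Nonempty (ι ≃ ι0) := by
      rw [← Cardinal.eq, hι, hc0]
    obtain ⟨f⟩ := heq
    refine prod_good x κ hκ hinf (ι := ι) (by rw [hι]; exact hι1) (p0 ∘ f) ?_ ?_ ?_ ?_ ?_ IH'
    · intro i j hij
      exact hd0 _ _ (fun h => hij (f.injective h))
    · intro i; exact hx0 _
    · intro i; exact hκ0 _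
    · have := f.surjective.iSup_comp p0
      simp only [Function.comp_def]
      rw [this]
      exact hs0
    · intro ι' p' hlt h1 h2 h3
      by_contra hcon
      push Not at hcon
      have : #ι' ∈ C := ⟨ι', p', rfl, h1, h2, h3, hcon⟩
      rw [hι] at hlt
      exact absurd (csInf_le' this) (not_le.2 hlt)

theorem final [Infinite B] : ∃ a : B → B, Ind (⊤ : B) a := by
  classical
  have hBinf : ℵ₀ ≤ #B := infinite_iff.1 inferInstance
  let At : Set B := {z | IsAtom z}
  let t : B := sSup At
  have hB : #B ≤ #(Iic t) * #(Iic tᶜ) := by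
    refine le_trans ?_ (N_sup t tᶜ)
    rw [sup_compl_eq_top, Iic_top, mk_univ]
  have hup : ∀ {K : Type u} (e : B), #B ≤ #K → (∃ a : K → B, Ind e a) →
      ∃ a : B → B, Ind (⊤ : B) a := by
    intro K e hK h
    obtain ⟨a, ha⟩ := ind_of_le hK h
    refine ⟨a, fun S σ => ?_⟩
    obtain ⟨y, h1, h2, h3⟩ := ha S σ
    exact ⟨y, h1, le_top, h3⟩
  by_cases hc : #(Iic t) ≤ #(Iic tᶜ)
  · have h1 : #B ≤ #(Iic tᶜ) * #(Iic tᶜ) := hB.trans (mul_le_mul_left hc _)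
    have h2 : ℵ₀ ≤ #(Iic tᶜ) := by
      by_contra hcon
      push Not at hcon
      exact absurd (hBinf.trans h1) (not_le.2 (mul_lt_aleph0 hcon hcon))
    rw [mul_eq_self h2] at h1
    have h3 : tᶜ ≠ ⊥ := by
      intro h
      rw [h] at h2
      simp only [Iic_bot, mk_fintype, Fintype.card_unique, Nat.cast_one] at h2
      exact absurd h2 (not_le.2 one_lt_aleph0)
    refine hup tᶜ h1 (good_atomless _ tᶜ h3 ?_ rfl)
    intro y hy hy0
    by_contra hcon
    push Not at hcon
    have : IsAtom y := ⟨hy0, fun z hz => hcon z hz⟩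
    have hyt : y ≤ t := le_sSup this
    exact hy0 (disjoint_self.1 (disjoint_compl_right.mono hyt hy))
  · push Not at hc
    have h1 : #B ≤ #(Iic t) * #(Iic t) := hB.trans (mul_le_mul_right hc.le _)
    have h2 : ℵ₀ ≤ #(Iic t) := by
      by_contra hcon
      push Not at hcon
      exact absurd (hBinf.trans h1) (not_le.2 (mul_lt_aleph0 hcon hcon))
    rw [mul_eq_self h2] at h1
    have h3 : #(Iic t) ≤ #(At → ULift.{u} Bool) := by
      refine mk_le_of_injective (f := fun y : Iic t => fun z : At => ULift.up (decide (z.1 ≤ y.1))) ?_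
      intro y y' h
      have key : ∀ y y' : Iic t, (∀ z : At, z.1 ≤ y.1 → z.1 ≤ y'.1) → y.1 ≤ y'.1 := by
        intro y y' hz
        rw [← inf_eq_left.2 y.2, inf_sSup_eq]
        refine iSup₂_le fun z hzA => ?_
        rcases (show IsAtom z from hzA).le_iff.1 (inf_le_right : y.1 ⊓ z ≤ z) with h | h
        · rw [h]; exact bot_le
        · rw [h]
          exact hz ⟨z, hzA⟩ (inf_eq_right.1 h)
      have hiff : ∀ z : At, z.1 ≤ y.1 ↔ z.1 ≤ y'.1 := by
        intro z
        have := congrArg ULift.down (congrFun h z)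
        simpa using this
      exact Subtype.ext (le_antisymm (key y y' fun z => (hiff z).1) (key y' y fun z => (hiff z).2))
    have hAinf : Infinite At := by
      by_contra hcon
      rw [not_infinite_iff_finite] at hcon
      exact absurd (h2.trans h3) (not_le.2 (lt_aleph0_of_finite _))
    have hm : MInd (⊤ : B) (J := PUnit.{u+1}) (I := fun _ => At) (fun _ z => z.1) := by
      intro s c
      exact ⟨(c PUnit.unit).1, (show IsAtom _ from (c PUnit.unit).2).1, le_top, fun j _ => le_rfl⟩
    refine hup ⊤ ?_ (hausdorff (⊤ : B) (J := PUnit.{u+1}) (I := fun _ => At) (fun _ z => z.1) ?_ hm)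
    · refine h1.trans (h3.trans ?_)
      exact mk_le_of_injective (f := fun g : At → ULift.{u} Bool =>
        (⟨PUnit.unit, g⟩ : Σ _ : PUnit.{u+1}, (At → ULift.{u} Bool)))
        (fun g g' h => by simpa using h)
    · intro _ z w hzw
      have hz : IsAtom z.1 := z.2
      have hw : IsAtom w.1 := w.2
      exact hz.disjoint_of_ne hw (fun h => hzw (Subtype.ext h))

end
end BF


/-- Every infinite complete Boolean algebra (every subset has a supremum)
has an ultrafilter `U` with `(U,≥) ≡_T ([|B|]^{<ω},⊆)` (realized as `Finset B`). -/
theorem stmt2 {B : Type*} [BooleanAlgebra B] [Infinite B]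
    (hcomplete : ∀ S : Set B, ∃ b : B, IsLUB S b) :
    ∃ U : BAUltrafilter B, TukeyEquiv ((↥U.carrier)ᵒᵈ) (Finset B) := by
  classical
  choose sup hsup using hcomplete
  let inst : CompleteBooleanAlgebra B :=
    { (inferInstance : BooleanAlgebra B) with
      sSup := sup
      sInf := fun S => sup (lowerBounds S)
      isLUB_sSup := hsup
      isGLB_sInf := fun S => ⟨fun a ha => (hsup (lowerBounds S)).2 (fun b hb => hb ha),
        fun a ha => (hsup (lowerBounds S)).1 ha⟩ }
  obtain ⟨a, ha⟩ := @BF.final B inst _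
  exact BF.tukey_of_ind a ha
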